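/- Let n ≥ 1, 0 < α < n, 1 < p < n/α, and let q be defined by 1/p − 1/q = α/n, and let w be a weight on ℝⁿ with w ∈ A_{p,q}^*. Then there is a constant C depending only on n, p, and α such that for every f ∈ L^p(w^p), ‖w·M_α f‖_{L^{q,∞}} ≤ C·[w]_{A_{p,q}^*}^{1 + p'/q}·‖f‖_{L^p(w^p)}. -/

import Mathlib

open MeasureTheory Set
open scoped ENNReal

noncomputable section

/-- An axis-parallel cube in `ℝⁿ` (realized as `Fin n → ℝ`) with positive finite side length. -/
def IsCube (n : ℕ) (Q : Set (Fin n → ℝ)) : Prop :=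
  ∃ (a : Fin n → ℝ) (h : ℝ), 0 < h ∧ Q = Set.univ.pi fun i => Set.Icc (a i) (a i + h)

/-- The weak `L^p` quasinorm `sup_{t>0} t · |{x : g x > t}|^{1/p}` of an `ℝ≥0∞`-valued
function on `ℝⁿ`. -/
def wnormE (n : ℕ) (p : ℝ) (g : (Fin n → ℝ) → ℝ≥0∞) : ℝ≥0∞ :=
  ⨆ (t : ℝ) (_ : 0 < t), ENNReal.ofReal t * volume {x | ENNReal.ofReal t < g x} ^ (1 / p)

/-- The Hardy–Littlewood maximal operator: supremum of averages of `|f|` over cubes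
containing `x`. -/
def maximalFn (n : ℕ) (f : (Fin n → ℝ) → ℝ) (x : Fin n → ℝ) : ℝ≥0∞ :=
  ⨆ (Q : Set (Fin n → ℝ)) (_ : IsCube n Q) (_ : x ∈ Q),
    (volume Q)⁻¹ * ∫⁻ y in Q, ENNReal.ofReal |f y|

/-- The fractional maximal operator `M_α`. -/
def fracMaximalFn (n : ℕ) (α : ℝ) (f : (Fin n → ℝ) → ℝ) (x : Fin n → ℝ) : ℝ≥0∞ :=
  ⨆ (Q : Set (Fin n → ℝ)) (_ : IsCube n Q) (_ : x ∈ Q),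
    volume Q ^ (α / (n : ℝ)) * ((volume Q)⁻¹ * ∫⁻ y in Q, ENNReal.ofReal |f y|)

/-- The multiplier `A_p^*` characteristic
`[w]_{A_p^*} = sup_Q (|Q|⁻¹·‖w·χ_Q‖_{L^{1,∞}})·(⨍_Q w^{1-p'})^{p-1}`, with `p' = p/(p-1)`. -/
def ApStarConst (n : ℕ) (p : ℝ) (w : (Fin n → ℝ) → ℝ) : ℝ≥0∞ :=
  ⨆ (Q : Set (Fin n → ℝ)) (_ : IsCube n Q),
    (volume Q)⁻¹ * wnormE n 1 (Q.indicator fun x => ENNReal.ofReal (w x)) *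
      ((volume Q)⁻¹ * ∫⁻ x in Q, ENNReal.ofReal (w x ^ (1 - p / (p - 1)))) ^ (p - 1)

/-- The multiplier `A_{p,q}^*` characteristic
`[w]_{A_{p,q}^*} = sup_Q (|Q|⁻¹·‖w^q·χ_Q‖_{L^{1,∞}})^{1/q}·(⨍_Q w^{-p'})^{1/p'}`,
with `p' = p/(p-1)` and `1/p' = 1 - 1/p`. -/
def ApqStarConst (n : ℕ) (p q : ℝ) (w : (Fin n → ℝ) → ℝ) : ℝ≥0∞ :=
  ⨆ (Q : Set (Fin n → ℝ)) (_ : IsCube n Q),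
    ((volume Q)⁻¹ * wnormE n 1 (Q.indicator fun x => ENNReal.ofReal (w x ^ q))) ^ (1 / q) *
      ((volume Q)⁻¹ * ∫⁻ x in Q, ENNReal.ofReal (w x ^ (-(p / (p - 1))))) ^ (1 - 1 / p)

/-- The Muckenhoupt `A_p` characteristic `[w]_{A_p} = sup_Q (⨍_Q w)·(⨍_Q w^{1-p'})^{p-1}`. -/
def ApConst (n : ℕ) (p : ℝ) (w : (Fin n → ℝ) → ℝ) : ℝ≥0∞ :=
  ⨆ (Q : Set (Fin n → ℝ)) (_ : IsCube n Q),
    ((volume Q)⁻¹ * ∫⁻ x in Q, ENNReal.ofReal (w x)) *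
      ((volume Q)⁻¹ * ∫⁻ x in Q, ENNReal.ofReal (w x ^ (1 - p / (p - 1)))) ^ (p - 1)

/-- The Muckenhoupt `A_{p,q}` characteristic
`[w]_{A_{p,q}} = sup_Q (⨍_Q w^q)^{1/q}·(⨍_Q w^{-p'})^{1/p'}`. -/
def ApqConst (n : ℕ) (p q : ℝ) (w : (Fin n → ℝ) → ℝ) : ℝ≥0∞ :=
  ⨆ (Q : Set (Fin n → ℝ)) (_ : IsCube n Q),
    ((volume Q)⁻¹ * ∫⁻ x in Q, ENNReal.ofReal (w x ^ q)) ^ (1 / q) *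
      ((volume Q)⁻¹ * ∫⁻ x in Q, ENNReal.ofReal (w x ^ (-(p / (p - 1))))) ^ (1 - 1 / p)

/-- An abstract nested family of partitions, generation `k` being given by the fibres of `π k`. -/
structure GridN {X Z : Type*} [MeasurableSpace X] (π : ℤ → X → Z) : Prop where
  meas : ∀ k z, MeasurableSet (π k ⁻¹' {z})
  nest : ∀ k x y, π (k + 1) x = π (k + 1) y → π k x = π k y

/-- the cell with given generation and index. -/
def cell {X Z : Type*} (π : ℤ → X → Z) (Q : ℤ × Z) : Set X := π Q.1 ⁻¹' {Q.2}

section Abstract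

variable {X Z : Type*} [MeasurableSpace X] {π : ℤ → X → Z}

lemma mem_cell {X Z : Type*} {π : ℤ → X → Z} {Q : ℤ × Z} {x : X} : x ∈ cell π Q ↔ π Q.1 x = Q.2 := Iff.rfl

lemma GridN.nest_le (hG : GridN π) {k l : ℤ} (hkl : k ≤ l) {x y : X} (h : π l x = π l y) :
    π k x = π k y := by
  induction l, hkl using Int.leInduction with
  | base => exact h
  | succ l hl ih => exact ih (hG.nest _ _ _ h)

lemma GridN.stopping (hG : GridN π) [Countable Z] (T : Set (ℤ × Z)) (k0 : ℤ)
    (hb : ∀ Q ∈ T, k0 ≤ Q.1) (μ ν : Measure X) (c : ℝ≥0∞)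
    (h : ∀ Q ∈ T, μ (cell π Q) ≤ c * ν (cell π Q)) :
    μ (⋃ Q ∈ T, cell π Q) ≤ c * ν (⋃ Q ∈ T, cell π Q) := by
  let T' : Set (ℤ × Z) := {Q | Q ∈ T ∧ ∀ x ∈ cell π Q, ∀ k < Q.1, (k, π k x) ∉ T}
  have hsub : T' ⊆ T := fun Q hQ => hQ.1
  have hU : (⋃ Q ∈ T, cell π Q) ⊆ ⋃ Q ∈ T', cell π Q := by
    intro x hx
    simp only [mem_iUnion] at hx
    obtain ⟨Q, hQ, hxQ⟩ := hx
    have hex : ∃ k, (k, π k x) ∈ T := ⟨Q.1, by rw [mem_cell.1 hxQ]; exact hQ⟩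
    obtain ⟨k, hk, hmin⟩ := Int.exists_least_of_bdd (P := fun k => (k, π k x) ∈ T)
      ⟨k0, fun z hz => hb _ hz⟩ hex
    simp only [mem_iUnion]
    refine ⟨(k, π k x), ⟨hk, ?_⟩, rfl⟩
    intro y hy l hl hlT
    have : π l y = π l x := hG.nest_le (le_of_lt hl) hy
    rw [this] at hlT
    exact absurd (hmin l hlT) (not_le.2 hl)
  have hd : T'.PairwiseDisjoint (cell π) := by
    intro Q hQ R hR hne
    rw [Function.onFun, Set.disjoint_left]
    intro x hx hx'
    rw [mem_cell] at hx hx'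
    rcases lt_trichotomy Q.1 R.1 with hlt | heq | hlt
    · refine hR.2 x hx' Q.1 hlt ?_
      rw [hx]; exact hQ.1
    · apply hne
      refine Prod.ext heq ?_
      rw [← hx, ← hx', heq]
    · refine hQ.2 x hx R.1 hlt ?_
      rw [hx']; exact hR.1
  have hm : ∀ Q ∈ T', MeasurableSet (cell π Q) := fun Q _ => hG.meas _ _
  calc μ (⋃ Q ∈ T, cell π Q) ≤ μ (⋃ Q ∈ T', cell π Q) := measure_mono hU
    _ = ∑' Q : T', μ (cell π Q) := measure_biUnion (Set.to_countable _) hd hm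
    _ ≤ ∑' Q : T', c * ν (cell π Q) := ENNReal.tsum_le_tsum fun Q => h _ Q.2.1
    _ = c * ν (⋃ Q ∈ T', cell π Q) := by
        rw [ENNReal.tsum_mul_left, measure_biUnion (Set.to_countable _) hd hm]
    _ ≤ c * ν (⋃ Q ∈ T, cell π Q) := by
        gcongr c * ?_
        exact measure_mono (biUnion_subset_biUnion_left hsub)

/-- average of `g` over the cell of generation `k` containing `x`. -/
def avg (π : ℤ → X → Z) (σ : Measure X) (g : X → ℝ≥0∞) (k : ℤ) (x : X) : ℝ≥0∞ :=
  (σ (π k ⁻¹' {π k x}))⁻¹ * ∫⁻ y in π k ⁻¹' {π k x}, g y ∂σ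

lemma GridN.weak (hG : GridN π) [Countable Z] (σ : Measure X)
    (hσ0 : ∀ k z, (π k ⁻¹' {z}).Nonempty → σ (π k ⁻¹' {z}) ≠ 0)
    (hσ : ∀ k z, σ (π k ⁻¹' {z}) ≠ ∞)
    (g : X → ℝ) (hg : Measurable g) (t : ℝ) (ht : 0 < t) :
    σ {x | ENNReal.ofReal t < ⨆ k, avg π σ (fun y => ENNReal.ofReal (g y)) k x} ≤
      ENNReal.ofReal (2 / t) *
        (σ.withDensity fun y => ENNReal.ofReal (g y)) {x | t < 2 * g x} := by
  set G : X → ℝ≥0∞ := fun y => ENNReal.ofReal (g y) with hGdef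
  have hGm : Measurable G := by fun_prop
  let A : ℕ → Set X := fun N => {x | ∃ k : ℤ, -(N : ℤ) ≤ k ∧ ENNReal.ofReal t < avg π σ G k x}
  have hA : {x | ENNReal.ofReal t < ⨆ k, avg π σ G k x} = ⋃ N, A N := by
    ext x
    simp only [mem_ofPred_eq, lt_iSup_iff, mem_iUnion, A]
    constructor
    · rintro ⟨k, hk⟩
      exact ⟨k.natAbs, k, by omega, hk⟩
    · rintro ⟨N, k, _, hk⟩
      exact ⟨k, hk⟩
  have hmono : Monotone A := by
    intro N M hNM x
    rintro ⟨k, hk, h⟩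
    exact ⟨k, by omega, h⟩
  rw [hA, hmono.measure_iUnion]
  refine iSup_le fun N => ?_
  have hS : MeasurableSet {x | t < 2 * g x} := measurableSet_lt measurable_const (by fun_prop)
  let ν : Measure X := (σ.withDensity G).restrict {x | t < 2 * g x}
  let T : Set (ℤ × Z) := {Q | -(N : ℤ) ≤ Q.1 ∧ (cell π Q).Nonempty ∧
    ENNReal.ofReal t < (σ (cell π Q))⁻¹ * ∫⁻ y in cell π Q, G y ∂σ}
  have hAT : A N ⊆ ⋃ Q ∈ T, cell π Q := by
    rintro x ⟨k, hk, h⟩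
    simp only [mem_iUnion]
    exact ⟨(k, π k x), ⟨hk, ⟨x, rfl⟩, h⟩, rfl⟩
  have key : ∀ Q ∈ T, σ (cell π Q) ≤ ENNReal.ofReal (2 / t) * ν (cell π Q) := by
    rintro Q ⟨-, hne, hQ⟩
    have hmQ : MeasurableSet (cell π Q) := hG.meas _ _
    have h0 : σ (cell π Q) ≠ 0 := hσ0 _ _ hne
    have h1 : σ (cell π Q) ≠ ∞ := hσ _ _
    have hν : ν (cell π Q) = ∫⁻ y in cell π Q, {x | t < 2 * g x}.indicator G y ∂σ := by
      rw [Measure.restrict_apply hmQ, withDensity_apply _ (hmQ.inter hS),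
        lintegral_indicator hS, Measure.restrict_restrict hS, inter_comm]
    have hintegral : ∫⁻ y in cell π Q, G y ∂σ ≤ ν (cell π Q) + ENNReal.ofReal (t / 2) * σ (cell π Q) := by
      rw [hν, ← setLIntegral_const, ← lintegral_add_right _ measurable_const]
      refine lintegral_mono fun y => ?_
      by_cases hy : t < 2 * g y
      · simp [indicator, hy]
      · have : G y ≤ ENNReal.ofReal (t / 2) := ENNReal.ofReal_le_ofReal (by linarith)
        simpa [indicator, hy] using this
    have hlt : ENNReal.ofReal t * σ (cell π Q) ≤ ∫⁻ y in cell π Q, G y ∂σ := by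
      calc _ ≤ ((σ (cell π Q))⁻¹ * ∫⁻ y in cell π Q, G y ∂σ) * σ (cell π Q) := by
            gcongr
        _ = (σ (cell π Q))⁻¹ * σ (cell π Q) * ∫⁻ y in cell π Q, G y ∂σ := by ring
        _ = _ := by rw [ENNReal.inv_mul_cancel h0 h1, one_mul]
    have h3 : ENNReal.ofReal (t / 2) * σ (cell π Q) ≤ ν (cell π Q) := by
      have e : ENNReal.ofReal t = ENNReal.ofReal (t / 2) + ENNReal.ofReal (t / 2) := by
        rw [← ENNReal.ofReal_add (by positivity) (by positivity)]; congr 1; ring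
      have := hlt.trans hintegral
      rw [e, add_mul] at this
      exact (ENNReal.add_le_add_iff_right (ENNReal.mul_ne_top ENNReal.ofReal_ne_top h1)).1 this
    calc σ (cell π Q) = ENNReal.ofReal (2 / t) * (ENNReal.ofReal (t / 2) * σ (cell π Q)) := by
          rw [← mul_assoc, ← ENNReal.ofReal_mul (by positivity)]
          rw [show 2 / t * (t / 2) = 1 by field_simp]; simp
      _ ≤ _ := by gcongr
  calc σ (A N) ≤ σ (⋃ Q ∈ T, cell π Q) := measure_mono hAT
    _ ≤ ENNReal.ofReal (2 / t) * ν (⋃ Q ∈ T, cell π Q) :=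
        hG.stopping T (-(N : ℤ)) (fun Q hQ => hQ.1) σ ν _ key
    _ ≤ ENNReal.ofReal (2 / t) * ν univ := by gcongr; exact subset_univ _
    _ = _ := by simp only [ν, Measure.restrict_apply_univ]; 

lemma GridN.meas_avg (hG : GridN π) [Countable Z] (σ : Measure X) (g : X → ℝ≥0∞) (k : ℤ) :
    Measurable (avg π σ g k) := by
  let _ : MeasurableSpace Z := ⊤
  have h1 : Measurable (π k) := measurable_to_countable' fun z => hG.meas k z
  exact (measurable_from_top (f := fun z : Z => (σ (π k ⁻¹' {z}))⁻¹ *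
    ∫⁻ y in π k ⁻¹' {z}, g y ∂σ)).comp h1

lemma GridN.strong (hG : GridN π) [Countable Z] (σ : Measure X)
    (hσ0 : ∀ k z, (π k ⁻¹' {z}).Nonempty → σ (π k ⁻¹' {z}) ≠ 0)
    (hσ : ∀ k z, σ (π k ⁻¹' {z}) ≠ ∞)
    (g : X → ℝ) (hg : Measurable g) (hg0 : ∀ x, 0 ≤ g x) (p : ℝ) (hp : 1 < p) :
    ∫⁻ x, (⨆ k, avg π σ (fun y => ENNReal.ofReal (g y)) k x) ^ p ∂σ ≤
      ENNReal.ofReal (p * 2 * (p - 1)⁻¹ * 2 ^ (p - 1)) * ∫⁻ x, ENNReal.ofReal (g x ^ p) ∂σ := by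
  set G : X → ℝ≥0∞ := fun y => ENNReal.ofReal (g y) with hGdef
  have hGm : Measurable G := by fun_prop
  set M : X → ℝ≥0∞ := fun x => ⨆ k, avg π σ G k x with hMdef
  have hMm : Measurable M := Measurable.iSup fun k => hG.meas_avg σ G k
  set ν := σ.withDensity G with hν
  have hp1 : 0 < p - 1 := by linarith
  have hR : ∀ R : ℕ, ∫⁻ x, (min (M x) R) ^ p ∂σ ≤
      ENNReal.ofReal (p * 2 * (p - 1)⁻¹ * 2 ^ (p - 1)) * ∫⁻ x, ENNReal.ofReal (g x ^ p) ∂σ := by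
    intro R
    have hfin : ∀ x, min (M x) R ≠ ∞ := fun x =>
      ne_top_of_le_ne_top (ENNReal.natCast_ne_top R) (min_le_right _ _)
    have e1 : ∀ x, (min (M x) R) ^ p = ENNReal.ofReal ((min (M x) R).toReal ^ p) := by
      intro x
      rw [← ENNReal.ofReal_rpow_of_nonneg ENNReal.toReal_nonneg (by linarith),
        ENNReal.ofReal_toReal (hfin x)]
    have e2 : ∫⁻ x, ENNReal.ofReal ((2 * g x) ^ (p - 1)) ∂ν =
        ENNReal.ofReal (2 ^ (p - 1)) * ∫⁻ x, ENNReal.ofReal (g x ^ p) ∂σ := by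
      rw [hν, lintegral_withDensity_eq_lintegral_mul _ hGm (by fun_prop),
        ← lintegral_const_mul _ (by fun_prop)]
      refine lintegral_congr fun x => ?_
      simp only [Pi.mul_apply, hGdef]
      rw [← ENNReal.ofReal_mul (hg0 x), ← ENNReal.ofReal_mul (by positivity),
        Real.mul_rpow (by norm_num) (hg0 x)]
      congr 1
      rcases eq_or_lt_of_le (hg0 x) with h | h
      · rw [← h, Real.zero_rpow (by linarith), Real.zero_rpow (by linarith)]; ring
      · rw [Real.rpow_sub h, Real.rpow_one]; field_simp
    simp_rw [e1]
    rw [lintegral_rpow_eq_lintegral_meas_lt_mul σ (Filter.Eventually.of_forall fun x => ENNReal.toReal_nonneg)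
      (by fun_prop) (by linarith)]
    have e3 := lintegral_rpow_eq_lintegral_meas_lt_mul ν
      (Filter.Eventually.of_forall fun x => (by have := hg0 x; positivity : 0 ≤ 2 * g x)) (f := fun x => 2 * g x)
      (by fun_prop) hp1
    rw [e2] at e3
    have e4 : ∫⁻ t in Ioi (0:ℝ), σ {a | t < (min (M a) R).toReal} * ENNReal.ofReal (t ^ (p - 1)) ≤
        ENNReal.ofReal 2 *
        ∫⁻ t in Ioi (0:ℝ), ν {a | t < 2 * g a} * ENNReal.ofReal (t ^ (p - 1 - 1)) := by
      rw [← lintegral_const_mul' _ _ ENNReal.ofReal_ne_top]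
      refine setLIntegral_mono' measurableSet_Ioi fun t ht => ?_
      have ht0 : 0 < t := ht
      have hw := hG.weak σ hσ0 hσ g hg t ht
      have hs : {a | t < (min (M a) R).toReal} ⊆ {x | ENNReal.ofReal t < M x} := by
        intro a ha
        have : ENNReal.ofReal t < min (M a) R := (ENNReal.ofReal_lt_iff_lt_toReal ht0.le (hfin a)).2 ha
        exact this.trans_le (min_le_left _ _)
      calc _ ≤ (ENNReal.ofReal (2 / t) * ν {a | t < 2 * g a}) * ENNReal.ofReal (t ^ (p - 1)) := by
            gcongr
            exact (measure_mono hs).trans hw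
        _ = (ENNReal.ofReal (2 / t) * ENNReal.ofReal (t ^ (p - 1))) * ν {a | t < 2 * g a} := by ring
        _ = (ENNReal.ofReal 2 * ENNReal.ofReal (t ^ (p - 1 - 1))) * ν {a | t < 2 * g a} := by
            rw [← ENNReal.ofReal_mul (by positivity), ← ENNReal.ofReal_mul (by positivity),
              Real.rpow_sub_one ht0.ne' (p - 1)]
            congr 2; field_simp
        _ = _ := by ring
    calc _ ≤ ENNReal.ofReal p * (ENNReal.ofReal 2 *
        ∫⁻ t in Ioi (0:ℝ), ν {a | t < 2 * g a} * ENNReal.ofReal (t ^ (p - 1 - 1))) := by gcongr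
      _ = ENNReal.ofReal p * ENNReal.ofReal 2 * (ENNReal.ofReal (p - 1)⁻¹ * (ENNReal.ofReal (p - 1) *
        ∫⁻ t in Ioi (0:ℝ), ν {a | t < 2 * g a} * ENNReal.ofReal (t ^ (p - 1 - 1)))) := by
          rw [← mul_assoc (ENNReal.ofReal (p - 1)⁻¹), ← ENNReal.ofReal_mul (inv_nonneg.2 hp1.le),
            inv_mul_cancel₀ hp1.ne']
          simp [mul_assoc]
      _ = _ := by
          rw [← e3, ENNReal.ofReal_mul (by positivity), ENNReal.ofReal_mul (by positivity),
            ENNReal.ofReal_mul (by positivity)]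
          ring
  have hsup : ∀ x, (M x) ^ p = ⨆ R : ℕ, (min (M x) R) ^ p := by
    intro x
    have hmono : (⨆ R : ℕ, min (M x) (R : ℝ≥0∞)) = M x := by
      rw [← inf_iSup_eq, ENNReal.iSup_natCast, inf_top_eq]
    have := (ENNReal.orderIsoRpow p (by linarith)).map_iSup (fun R : ℕ => min (M x) (R : ℝ≥0∞))
    rw [hmono] at this
    exact this
  rw [lintegral_congr hsup]
  rw [lintegral_iSup (fun R => by fun_prop)]
  · exact iSup_le hR
  · intro R S hRS x
    have : (R : ℝ≥0∞) ≤ S := by exact_mod_cast hRS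
    simp only
    gcongr

end Abstract
section Cube

/-- Power arithmetic for a single cube. -/
lemma cube_algebra {m s B I K N : ℝ≥0∞} {p q β : ℝ} (hm0 : m ≠ 0) (hm : m ≠ ∞) (hs0 : s ≠ 0)
    (hs : s ≠ ∞) (hI0 : I ≠ 0) (hI : I ≠ ∞) (hp : 1 < p) (hpq : p < q) (hβ : 1 / p - 1 / q = β)
    (hK : (m⁻¹ * B) ^ (1 / q) * (m⁻¹ * s) ^ (1 - 1 / p) ≤ K)
    (hH : I ≤ N ^ (1 / p) * s ^ (1 - 1 / p)) :
    (m ^ β * (m⁻¹ * I)) ^ q * B ≤ K ^ q * N ^ ((q - p) / p) * ((s⁻¹ * I) ^ p * s) := by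
  have hq : 0 < q := by linarith
  have hp0 : 0 < p := by linarith
  set r : ℝ := q * (1 - 1 / p) with hr
  have h1 : (m⁻¹ * B) * (m⁻¹ * s) ^ r ≤ K ^ q := by
    have := ENNReal.rpow_le_rpow hK hq.le
    rw [ENNReal.mul_rpow_of_nonneg _ _ hq.le, ← ENNReal.rpow_mul, ← ENNReal.rpow_mul,
      one_div_mul_cancel hq.ne', ENNReal.rpow_one, mul_comm _ q] at this
    exact this
  have hms0 : m⁻¹ * s ≠ 0 := mul_ne_zero (ENNReal.inv_ne_zero.2 hm) hs0
  have hms : m⁻¹ * s ≠ ∞ := ENNReal.mul_ne_top (ENNReal.inv_ne_top.2 hm0) hs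
  have hr0 : 0 ≤ r := by
    have : 1 / p ≤ 1 := by rw [div_le_one hp0]; exact hp.le
    exact mul_nonneg hq.le (by linarith)
  have h2 : B ≤ K ^ q * (m * m ^ r * s ^ (-r)) := by
    calc B = (m⁻¹ * B) * (m⁻¹ * s) ^ r * ((m⁻¹ * s) ^ (-r) * m) := by
          rw [ENNReal.rpow_neg]
          rw [show (m⁻¹ * B) * (m⁻¹ * s) ^ r * (((m⁻¹ * s) ^ r)⁻¹ * m) =
            (m⁻¹ * m) * (((m⁻¹ * s) ^ r) * ((m⁻¹ * s) ^ r)⁻¹) * B by ring]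
          rw [ENNReal.inv_mul_cancel hm0 hm, ENNReal.mul_inv_cancel]
          · simp
          · exact (ENNReal.rpow_pos (pos_iff_ne_zero.2 hms0) hms).ne'
          · exact ENNReal.rpow_ne_top_of_nonneg hr0 hms
      _ ≤ K ^ q * ((m⁻¹ * s) ^ (-r) * m) := by gcongr
      _ = _ := by
          rw [ENNReal.mul_rpow_of_ne_top (ENNReal.inv_ne_top.2 hm0) hs, ENNReal.inv_rpow,
            ← ENNReal.rpow_neg, neg_neg]
          ring
  have h3 : I ^ q ≤ I ^ p * (N ^ ((q - p) / p) * s ^ ((1 - 1 / p) * (q - p))) := by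
    have : I ^ (q - p) ≤ N ^ ((q - p) / p) * s ^ ((1 - 1 / p) * (q - p)) := by
      have := ENNReal.rpow_le_rpow hH (by linarith : 0 ≤ q - p)
      rw [ENNReal.mul_rpow_of_nonneg _ _ (by linarith), ← ENNReal.rpow_mul, ← ENNReal.rpow_mul] at this
      rwa [show 1 / p * (q - p) = (q - p) / p by ring] at this
    calc I ^ q = I ^ p * I ^ (q - p) := by
          rw [← ENNReal.rpow_add _ _ hI0 hI]; congr 1; ring
      _ ≤ _ := by gcongr
  calc (m ^ β * (m⁻¹ * I)) ^ q * B
      ≤ (m ^ β * (m⁻¹ * I)) ^ q * (K ^ q * (m * m ^ r * s ^ (-r))) := by gcongr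
    _ = K ^ q * (m ^ (β * q) * m ^ (-q) * m * m ^ r) * s ^ (-r) * I ^ q := by
        rw [ENNReal.mul_rpow_of_nonneg _ _ hq.le, ENNReal.mul_rpow_of_nonneg _ _ hq.le,
          ← ENNReal.rpow_mul, ENNReal.inv_rpow, ← ENNReal.rpow_neg]
        ring
    _ = K ^ q * s ^ (-r) * I ^ q := by
        nth_rewrite 3 [← ENNReal.rpow_one m]
        rw [← ENNReal.rpow_add _ _ hm0 hm, ← ENNReal.rpow_add _ _ hm0 hm,
          ← ENNReal.rpow_add _ _ hm0 hm]
        rw [show β * q + -q + 1 + r = 0 by rw [hr, ← hβ]; field_simp; ring]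
        simp
    _ ≤ K ^ q * s ^ (-r) * (I ^ p * (N ^ ((q - p) / p) * s ^ ((1 - 1 / p) * (q - p)))) := by gcongr
    _ = K ^ q * N ^ ((q - p) / p) * (I ^ p * (s ^ (-r) * s ^ ((1 - 1 / p) * (q - p)))) := by ring
    _ = _ := by
        rw [ENNReal.mul_rpow_of_nonneg _ _ hp0.le, ENNReal.inv_rpow, ← ENNReal.rpow_neg,
          ← ENNReal.rpow_add _ _ hs0 hs]
        nth_rewrite 3 [← ENNReal.rpow_one s]
        rw [mul_right_comm (s ^ (-p)), ← ENNReal.rpow_add _ _ hs0 hs]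
        rw [show -r + (1 - 1 / p) * (q - p) = -p + 1 by rw [hr]; field_simp; ring]
        ring

variable {X : Type*} [MeasurableSpace X]

/-- the measure `w^{-p'} dμ`. -/
def sig (μ : Measure X) (p : ℝ) (w : X → ℝ) : Measure X :=
  μ.withDensity fun x => ENNReal.ofReal (w x ^ (-(p / (p - 1))))

lemma cube_nondeg {μ : Measure X} {w : X → ℝ} (hw : Measurable w)
    (hpos : ∀ᵐ x ∂μ, 0 < w x) {p q : ℝ} (hp : 1 < p) (hq : 0 < q) {Q : Set X} (hQ : MeasurableSet Q)
    (hQ0 : μ Q ≠ 0) (hQt : μ Q ≠ ∞) {B K : ℝ≥0∞} (hKt : K ≠ ∞)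
    (hB : ∀ t : ℝ, 0 < t → ENNReal.ofReal t * μ (Q ∩ {x | t < w x ^ q}) ≤ B)
    (hK : ((μ Q)⁻¹ * B) ^ (1 / q) * ((μ Q)⁻¹ * sig μ p w Q) ^ (1 - 1 / p) ≤ K) :
    B ≠ 0 ∧ B ≠ ∞ ∧ sig μ p w Q ≠ 0 ∧ sig μ p w Q ≠ ∞ := by
  have hr : 0 < 1 - 1 / p := by
    have : 1 / p < 1 := by rw [div_lt_one (by linarith)]; exact hp
    linarith
  have hq' : 0 < 1 / q := by positivity
  have hi0 : (μ Q)⁻¹ ≠ 0 := ENNReal.inv_ne_zero.2 hQt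
  have hit : (μ Q)⁻¹ ≠ ∞ := ENNReal.inv_ne_top.2 hQ0
  have hB0 : B ≠ 0 := by
    intro h0
    apply hQ0
    have h1 : ∀ N : ℕ, μ (Q ∩ {x | (1 / ((N : ℝ) + 1)) < w x ^ q}) = 0 := by
      intro N
      have := hB (1 / ((N : ℝ) + 1)) (by positivity)
      rw [h0, nonpos_iff_eq_zero, mul_eq_zero] at this
      refine this.resolve_left ?_
      rw [ENNReal.ofReal_eq_zero, not_le]
      positivity
    have h2 : Q ⊆ (⋃ N : ℕ, Q ∩ {x | (1 / ((N : ℝ) + 1)) < w x ^ q}) ∪ {x | ¬ 0 < w x} := by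
      intro x hx
      by_cases hxw : 0 < w x
      · left
        obtain ⟨N, hN⟩ := exists_nat_one_div_lt (Real.rpow_pos_of_pos hxw q)
        exact mem_iUnion.2 ⟨N, hx, hN⟩
      · right; exact hxw
    refine measure_mono_null h2 (measure_union_null (measure_iUnion_null h1) hpos)
  have hwm : Measurable fun x => ENNReal.ofReal (w x ^ (-(p / (p - 1)))) := by fun_prop
  have hs0 : sig μ p w Q ≠ 0 := by
    rw [sig, withDensity_apply _ hQ, Ne, lintegral_eq_zero_iff hwm]
    intro h
    apply hQ0
    have h' : ∀ᵐ x ∂(μ.restrict Q), False := by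
      filter_upwards [h, ae_restrict_of_ae hpos] with x hx hx'
      simp only [Pi.zero_apply, ENNReal.ofReal_eq_zero] at hx
      exact absurd (Real.rpow_pos_of_pos hx' _) (not_lt.2 hx)
    simpa using h'
  refine ⟨hB0, ?_, hs0, ?_⟩
  · intro hBt
    apply hKt
    rw [eq_top_iff]
    refine le_trans ?_ hK
    rw [hBt, ENNReal.mul_top hi0, ENNReal.top_rpow_of_pos hq', ENNReal.top_mul]
    simp only [ne_eq, ENNReal.rpow_eq_zero_iff, not_or, not_and]
    refine ⟨fun h => absurd h (mul_ne_zero hi0 hs0), fun _ => not_lt.2 hr.le⟩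
  · intro hst
    apply hKt
    rw [eq_top_iff]
    refine le_trans ?_ hK
    rw [hst, ENNReal.mul_top hi0, ENNReal.top_rpow_of_pos hr, ENNReal.mul_top]
    simp only [ne_eq, ENNReal.rpow_eq_zero_iff, not_or, not_and]
    refine ⟨fun h => absurd h (mul_ne_zero hi0 hB0), fun _ => not_lt.2 hq'.le⟩

lemma cube_sparse {μ : Measure X} {w : X → ℝ} (hw : Measurable w)
    (hpos : ∀ᵐ x ∂μ, 0 < w x) {p q : ℝ} (hp : 1 < p) (hq : 0 < q) {Q : Set X} (hQ : MeasurableSet Q)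
    (hQ0 : μ Q ≠ 0) (hQt : μ Q ≠ ∞) {B K : ℝ≥0∞} (hKt : K ≠ ∞)
    (hB : ∀ t : ℝ, 0 < t → ENNReal.ofReal t * μ (Q ∩ {x | t < w x ^ q}) ≤ B)
    (hK : ((μ Q)⁻¹ * B) ^ (1 / q) * ((μ Q)⁻¹ * sig μ p w Q) ^ (1 - 1 / p) ≤ K)
    {E : Set X} (hE : MeasurableSet E) (hEQ : μ (Q \ E) ≤ 2⁻¹ * μ Q) :
    sig μ p w Q ≤ 4 * 4 ^ (p / (p - 1) / q) * K ^ (p / (p - 1)) * sig μ p w E := by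
  obtain ⟨hB0, hBt, hs0, hst⟩ := cube_nondeg hw hpos hp hq hQ hQ0 hQt hKt hB hK
  have hp1 : 0 < p - 1 := by linarith
  set p' := p / (p - 1) with hp'
  have hp'0 : 0 < p' := by positivity
  set m := μ Q with hm
  set s := sig μ p w Q with hs
  set τ : ℝ := (4 * (m⁻¹ * B)).toReal with hτ
  have hτt : 4 * (m⁻¹ * B) ≠ ∞ := ENNReal.mul_ne_top (by norm_num)
    (ENNReal.mul_ne_top (ENNReal.inv_ne_top.2 hQ0) hBt)
  have hτ0 : 4 * (m⁻¹ * B) ≠ 0 := mul_ne_zero (by norm_num)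
    (mul_ne_zero (ENNReal.inv_ne_zero.2 hQt) hB0)
  have hτe : ENNReal.ofReal τ = 4 * (m⁻¹ * B) := ENNReal.ofReal_toReal hτt
  have hτp : 0 < τ := ENNReal.toReal_pos hτ0 hτt
  have h1 : μ (Q ∩ {x | τ < w x ^ q}) ≤ 4⁻¹ * m := by
    have := hB τ hτp
    rw [hτe] at this
    calc _ = B⁻¹ * (4⁻¹ * m) * (4 * (m⁻¹ * B) * μ (Q ∩ {x | τ < w x ^ q})) := by
          rw [show B⁻¹ * (4⁻¹ * m) * (4 * (m⁻¹ * B) * μ (Q ∩ {x | τ < w x ^ q})) =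
            (B⁻¹ * B) * (4⁻¹ * 4) * (m⁻¹ * m) * μ (Q ∩ {x | τ < w x ^ q}) by ring]
          rw [ENNReal.inv_mul_cancel hB0 hBt, ENNReal.inv_mul_cancel (by norm_num) (by norm_num),
            ENNReal.inv_mul_cancel hQ0 hQt]; simp
      _ ≤ B⁻¹ * (4⁻¹ * m) * B := by gcongr
      _ = (B⁻¹ * B) * (4⁻¹ * m) := by ring
      _ = _ := by rw [ENNReal.inv_mul_cancel hB0 hBt, one_mul]
  set E' := E ∩ {x | w x ^ q ≤ τ} with hE'
  have hE'm : MeasurableSet E' := hE.inter (measurableSet_le (by fun_prop) measurable_const)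
  have h2 : 4⁻¹ * m ≤ μ E' := by
    have hsub : Q ⊆ (Q \ E) ∪ (Q ∩ {x | τ < w x ^ q}) ∪ E' := by
      intro x hx
      by_cases hxE : x ∈ E
      · by_cases hxt : τ < w x ^ q
        · exact Or.inl (Or.inr ⟨hx, hxt⟩)
        · exact Or.inr ⟨hxE, not_lt.1 hxt⟩
      · exact Or.inl (Or.inl ⟨hx, hxE⟩)
    have h3 : m ≤ 2⁻¹ * m + 4⁻¹ * m + μ E' := by
      calc m ≤ μ ((Q \ E) ∪ (Q ∩ {x | τ < w x ^ q}) ∪ E') := measure_mono hsub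
        _ ≤ μ (Q \ E) + μ (Q ∩ {x | τ < w x ^ q}) + μ E' := by
            refine (measure_union_le _ _).trans ?_
            gcongr
            exact measure_union_le _ _
        _ ≤ _ := by gcongr
    have h4 : (1 : ℝ≥0∞) = 2⁻¹ + 4⁻¹ + 4⁻¹ := by
      have : (4⁻¹ : ℝ≥0∞) = 2⁻¹ * 2⁻¹ := by
        rw [← ENNReal.mul_inv (by norm_num) (by norm_num)]; norm_num
      rw [add_assoc, this, ← mul_add, ENNReal.inv_two_add_inv_two, mul_one,
        ENNReal.inv_two_add_inv_two]
    have h5 : m = 2⁻¹ * m + 4⁻¹ * m + 4⁻¹ * m := by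
      rw [← add_mul, ← add_mul, ← h4, one_mul]
    rw [h5] at h3
    conv at h3 => rhs; rw [← h5]
    have hfin : 2⁻¹ * m + 4⁻¹ * m ≠ ∞ := by
      rw [← add_mul]; exact ENNReal.mul_ne_top (by simp) hQt
    exact (ENNReal.add_le_add_iff_left hfin).1 h3
  have h6 : ENNReal.ofReal (τ ^ (-(p' / q))) * μ E' ≤ sig μ p w E := by
    calc _ = ∫⁻ x in E', ENNReal.ofReal (τ ^ (-(p' / q))) ∂μ := by rw [setLIntegral_const]
      _ ≤ ∫⁻ x in E', ENNReal.ofReal (w x ^ (-p')) ∂μ := by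
          apply lintegral_mono_ae
          filter_upwards [ae_restrict_of_ae hpos, ae_restrict_mem hE'm] with x hx hxE
          apply ENNReal.ofReal_le_ofReal
          have hxq : w x ^ q ≤ τ := hxE.2
          have := Real.rpow_le_rpow_of_nonpos (Real.rpow_pos_of_pos hx q) hxq
            (by have : 0 < p' / q := by positivity
                linarith : -(p' / q) ≤ 0)
          rw [← Real.rpow_mul hx.le] at this
          rwa [show q * -(p' / q) = -p' by field_simp] at this
      _ = sig μ p w E' := by rw [sig, withDensity_apply _ hE'm]
      _ ≤ sig μ p w E := measure_mono inter_subset_left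
  have h7 : (m⁻¹ * B) ^ (p' / q) * (m⁻¹ * s) ≤ K ^ p' := by
    have := ENNReal.rpow_le_rpow hK hp'0.le
    rw [ENNReal.mul_rpow_of_nonneg _ _ hp'0.le, ← ENNReal.rpow_mul, ← ENNReal.rpow_mul,
      show (1 - 1 / p) * p' = 1 by rw [hp']; field_simp, ENNReal.rpow_one,
      show 1 / q * p' = p' / q by ring] at this
    exact this
  have hmB0 : m⁻¹ * B ≠ 0 := mul_ne_zero (ENNReal.inv_ne_zero.2 hQt) hB0
  have hmBt : m⁻¹ * B ≠ ∞ := ENNReal.mul_ne_top (ENNReal.inv_ne_top.2 hQ0) hBt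
  have hpq' : 0 < p' / q := by positivity
  have h8 : ENNReal.ofReal (τ ^ (-(p' / q))) * 4 ^ (p' / q) * (m⁻¹ * B) ^ (p' / q) = 1 := by
    rw [← ENNReal.ofReal_rpow_of_pos hτp, hτe, mul_assoc, ← ENNReal.mul_rpow_of_nonneg _ _ hpq'.le,
      ENNReal.rpow_neg, ENNReal.inv_mul_cancel]
    · exact (ENNReal.rpow_pos (pos_iff_ne_zero.2 hτ0) hτt).ne'
    · exact ENNReal.rpow_ne_top_of_nonneg hpq'.le hτt
  calc s = (m⁻¹ * m) * (ENNReal.ofReal (τ ^ (-(p' / q))) * 4 ^ (p' / q) * (m⁻¹ * B) ^ (p' / q)) * s := by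
        rw [h8, ENNReal.inv_mul_cancel hQ0 hQt]; simp
    _ = ENNReal.ofReal (τ ^ (-(p' / q))) * 4 ^ (p' / q) * m * ((m⁻¹ * B) ^ (p' / q) * (m⁻¹ * s)) := by
        ring
    _ ≤ ENNReal.ofReal (τ ^ (-(p' / q))) * 4 ^ (p' / q) * m * K ^ p' := by gcongr
    _ = 4 * 4 ^ (p' / q) * K ^ p' * (ENNReal.ofReal (τ ^ (-(p' / q))) * (4⁻¹ * m)) := by
        rw [show 4 * 4 ^ (p' / q) * K ^ p' * (ENNReal.ofReal (τ ^ (-(p' / q))) * (4⁻¹ * m)) =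
          (4⁻¹ * 4) * (ENNReal.ofReal (τ ^ (-(p' / q))) * 4 ^ (p' / q) * m * K ^ p') by ring]
        rw [ENNReal.inv_mul_cancel (by norm_num) (by norm_num), one_mul]
    _ ≤ 4 * 4 ^ (p' / q) * K ^ p' * (ENNReal.ofReal (τ ^ (-(p' / q))) * μ E') := by gcongr
    _ ≤ _ := by gcongr

end Cube
section Dyadic

variable {X Z : Type*} [MeasurableSpace X] {π : ℤ → X → Z}

/-- fractional average over a cell. -/
def vv (π : ℤ → X → Z) (μ : Measure X) (V : ℤ → ℝ≥0∞) (β : ℝ) (F : X → ℝ≥0∞) (Q : ℤ × Z) : ℝ≥0∞ :=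
  V Q.1 ^ β * ((V Q.1)⁻¹ * ∫⁻ y in cell π Q, F y ∂μ)

lemma V_anti {V : ℤ → ℝ≥0∞} {b : ℝ≥0∞} (hb : 1 < b) (hVb : ∀ k, V k = b * V (k + 1)) {k l : ℤ}
    (h : k ≤ l) : V l ≤ V k := by
  induction l, h using Int.leInduction with
  | base => exact le_rfl
  | succ l hl ih =>
    refine le_trans ?_ ih
    rw [hVb l]
    calc V (l + 1) = 1 * V (l + 1) := (one_mul _).symm
      _ ≤ _ := by gcongr

lemma V_large {V : ℤ → ℝ≥0∞} {b : ℝ≥0∞} (hb : 1 < b) (hV0 : ∀ k, V k ≠ 0) (hVt : ∀ k, V k ≠ ∞)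
    (hVb : ∀ k, V k = b * V (k + 1)) {R : ℝ≥0∞} (hR : R ≠ ∞) :
    ∃ k0 : ℤ, ∀ k ≤ k0, R ≤ V k := by
  have h1 : ∀ m : ℕ, V (-(m : ℤ)) = b ^ m * V 0 := by
    intro m
    induction m with
    | zero => simp
    | succ m ih =>
      rw [hVb, show (-((m + 1 : ℕ) : ℤ) + 1) = -(m : ℤ) by push_cast; ring, ih, pow_succ]
      ring
  have h2 := ENNReal.tendsto_pow_atTop_nhds_top_iff.2 hb
  have h3 : ∀ᶠ m : ℕ in Filter.atTop, R * (V 0)⁻¹ < b ^ m :=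
    h2.eventually (lt_mem_nhds (lt_top_iff_ne_top.2 (ENNReal.mul_ne_top hR (ENNReal.inv_ne_top.2 (hV0 0)))))
  obtain ⟨m, hm⟩ := h3.exists
  refine ⟨-(m : ℤ), fun k hk => le_trans ?_ (V_anti hb hVb hk)⟩
  rw [h1]
  calc R = R * (V 0)⁻¹ * V 0 := by rw [mul_assoc, ENNReal.inv_mul_cancel (hV0 0) (hVt 0), mul_one]
    _ ≤ _ := by gcongr

lemma vv_small {V : ℤ → ℝ≥0∞} {b : ℝ≥0∞} (hb : 1 < b) (hV0 : ∀ k, V k ≠ 0) (hVt : ∀ k, V k ≠ ∞)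
    (hVb : ∀ k, V k = b * V (k + 1)) {β : ℝ} (hβ : β < 1) {J lam : ℝ≥0∞} (hJ : J ≠ ∞)
    (hl : lam ≠ 0) : ∃ k0 : ℤ, ∀ k ≤ k0, V k ^ β * ((V k)⁻¹ * J) ≤ lam := by
  rcases eq_or_ne lam ∞ with rfl | hlt
  · exact ⟨0, fun _ _ => le_top⟩
  have h1 : 0 < 1 - β := by linarith
  have hR : (J * lam⁻¹) ^ (1 / (1 - β)) ≠ ∞ :=
    ENNReal.rpow_ne_top_of_nonneg (by positivity) (ENNReal.mul_ne_top hJ (ENNReal.inv_ne_top.2 hl))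
  obtain ⟨k0, hk0⟩ := V_large hb hV0 hVt hVb hR
  refine ⟨k0, fun k hk => ?_⟩
  have h2 := ENNReal.rpow_le_rpow (hk0 k hk) h1.le
  rw [← ENNReal.rpow_mul, one_div_mul_cancel h1.ne', ENNReal.rpow_one] at h2
  have e : V k ^ β * (V k)⁻¹ = (V k ^ (1 - β))⁻¹ := by
    rw [← ENNReal.rpow_neg, ← ENNReal.rpow_neg_one, ← ENNReal.rpow_add _ _ (hV0 k) (hVt k)]
    congr 1; ring
  have hX0 : V k ^ (1 - β) ≠ 0 := (ENNReal.rpow_pos (pos_iff_ne_zero.2 (hV0 k)) (hVt k)).ne'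
  have hXt : V k ^ (1 - β) ≠ ∞ := ENNReal.rpow_ne_top_of_nonneg h1.le (hVt k)
  rw [← mul_assoc, e]
  calc _ = (V k ^ (1 - β))⁻¹ * ((J * lam⁻¹) * lam) := by
        rw [mul_assoc J, ENNReal.inv_mul_cancel hl hlt, mul_one]
    _ ≤ (V k ^ (1 - β))⁻¹ * (V k ^ (1 - β) * lam) := by gcongr
    _ = lam := by rw [← mul_assoc, ENNReal.inv_mul_cancel hX0 hXt, one_mul]

lemma GridN.sparse (hG : GridN π) [Countable Z] {μ : Measure X} {V : ℤ → ℝ≥0∞} {b : ℝ≥0∞}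
    (hb : 1 < b) (hbt : b ≠ ∞) (hV0 : ∀ k, V k ≠ 0) (hVt : ∀ k, V k ≠ ∞)
    (hVb : ∀ k, V k = b * V (k + 1)) (hμ : ∀ Q, μ (cell π Q) = V Q.1) {β : ℝ} (hβ : 0 < β)
    {F : X → ℝ≥0∞} {lam : ℝ≥0∞} (hl0 : lam ≠ 0) (hlt : lam ≠ ∞) (Q : ℤ × Z)
    (hQ : vv π μ V β F Q ≤ b * lam) :
    μ (cell π Q ∩ {x | ∃ k, Q.1 ≤ k ∧ 2 * b * lam < vv π μ V β F (k, π k x)}) ≤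
      2⁻¹ * μ (cell π Q) := by
  have hb0 : b ≠ 0 := (zero_lt_one.trans hb).ne'
  set A := 2 * b * lam with hA
  have hA0 : A ≠ 0 := mul_ne_zero (mul_ne_zero (by norm_num) hb0) hl0
  have hAt : A ≠ ∞ := ENNReal.mul_ne_top (ENNReal.mul_ne_top (by norm_num) hbt) hlt
  let T : Set (ℤ × Z) := {R | Q.1 ≤ R.1 ∧ cell π R ⊆ cell π Q ∧ A < vv π μ V β F R}
  have hmQ : MeasurableSet (cell π Q) := hG.meas _ _
  have hsub : cell π Q ∩ {x | ∃ k, Q.1 ≤ k ∧ A < vv π μ V β F (k, π k x)} ⊆ ⋃ R ∈ T, cell π R := by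
    rintro x ⟨hx, k, hk, hA⟩
    simp only [mem_iUnion]
    refine ⟨(k, π k x), ⟨hk, ?_, hA⟩, rfl⟩
    intro y hy
    have : π Q.1 y = π Q.1 x := hG.nest_le hk hy
    exact mem_cell.2 (this.trans hx)
  have hT : (⋃ R ∈ T, cell π R) ⊆ cell π Q := iUnion₂_subset fun R hR => hR.2.1
  have key : ∀ R ∈ T, μ (cell π R) ≤ (A⁻¹ * V Q.1 ^ β) * (μ.withDensity F) (cell π R) := by
    rintro R ⟨hk, -, hR⟩
    have hmR : MeasurableSet (cell π R) := hG.meas _ _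
    rw [withDensity_apply _ hmR, hμ]
    have h1 : V R.1 ≤ V Q.1 := V_anti hb hVb hk
    calc V R.1 = A⁻¹ * (A * V R.1) := by
          rw [← mul_assoc, ENNReal.inv_mul_cancel hA0 hAt, one_mul]
      _ ≤ A⁻¹ * (vv π μ V β F R * V R.1) := by gcongr
      _ = A⁻¹ * (V R.1 ^ β * ((V R.1)⁻¹ * V R.1) * ∫⁻ y in cell π R, F y ∂μ) := by
          rw [vv]; ring
      _ = A⁻¹ * V R.1 ^ β * ∫⁻ y in cell π R, F y ∂μ := by
          rw [ENNReal.inv_mul_cancel (hV0 _) (hVt _), mul_one, mul_assoc]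
      _ ≤ _ := by gcongr
  calc _ ≤ μ (⋃ R ∈ T, cell π R) := measure_mono hsub
    _ ≤ (A⁻¹ * V Q.1 ^ β) * (μ.withDensity F) (⋃ R ∈ T, cell π R) :=
        hG.stopping T Q.1 (fun R hR => hR.1) _ _ _ key
    _ ≤ (A⁻¹ * V Q.1 ^ β) * (μ.withDensity F) (cell π Q) := by gcongr
    _ = A⁻¹ * (V Q.1 * vv π μ V β F Q) := by
        rw [withDensity_apply _ hmQ, vv]
        rw [show V Q.1 * (V Q.1 ^ β * ((V Q.1)⁻¹ * ∫⁻ y in cell π Q, F y ∂μ)) =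
          (V Q.1)⁻¹ * V Q.1 * (V Q.1 ^ β * ∫⁻ y in cell π Q, F y ∂μ) by ring]
        rw [ENNReal.inv_mul_cancel (hV0 _) (hVt _)]; ring
    _ ≤ A⁻¹ * (V Q.1 * (b * lam)) := by gcongr
    _ = 2⁻¹ * V Q.1 * ((b * lam)⁻¹ * (b * lam)) := by
        rw [hA, mul_assoc 2, ENNReal.mul_inv (Or.inl (by norm_num)) (Or.inl (by norm_num))]; ring
    _ = 2⁻¹ * μ (cell π Q) := by
        rw [ENNReal.inv_mul_cancel (mul_ne_zero hb0 hl0) (ENNReal.mul_ne_top hbt hlt), mul_one, hμ]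

lemma GridN.vv_parent (hG : GridN π) {μ : Measure X} {V : ℤ → ℝ≥0∞} {b : ℝ≥0∞}
    (hb : 1 < b) (hbt : b ≠ ∞)
    (hVb : ∀ k, V k = b * V (k + 1)) {β : ℝ} (hβ : 0 < β) (F : X → ℝ≥0∞) (k : ℤ) (x : X) :
    vv π μ V β F (k + 1, π (k + 1) x) ≤ b * vv π μ V β F (k, π k x) := by
  have hb0 : b ≠ 0 := (zero_lt_one.trans hb).ne'
  have hsub : cell π (k + 1, π (k + 1) x) ⊆ cell π (k, π k x) := fun y hy => hG.nest _ _ _ hy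
  have hV := V_anti hb hVb (show k ≤ k + 1 by omega)
  have e : (V (k + 1))⁻¹ = b * (V k)⁻¹ := by
    rw [hVb k, ENNReal.mul_inv (Or.inl hb0) (Or.inl hbt), ← mul_assoc,
      ENNReal.mul_inv_cancel hb0 hbt, one_mul]
  calc _ = V (k + 1) ^ β * ((b * (V k)⁻¹) * ∫⁻ y in cell π (k + 1, π (k + 1) x), F y ∂μ) := by
        rw [vv, e]
    _ ≤ V k ^ β * ((b * (V k)⁻¹) * ∫⁻ y in cell π (k, π k x), F y ∂μ) := by
        gcongr
    _ = _ := by rw [vv]; ring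

end Dyadic
section DyadicMain

variable {X Z : Type*} [MeasurableSpace X] {π : ℤ → X → Z}

lemma sig_f {μ : Measure X} {w f : X → ℝ} (hw : Measurable w) (hf : Measurable f)
    (hpos : ∀ᵐ x ∂μ, 0 < w x) {p : ℝ} {Q : Set X} (hQ : MeasurableSet Q) :
    ∫⁻ x in Q, ENNReal.ofReal (|f x| * w x ^ (p / (p - 1))) ∂(sig μ p w) =
      ∫⁻ x in Q, ENNReal.ofReal |f x| ∂μ := by
  rw [sig, setLIntegral_withDensity_eq_setLIntegral_mul _ (by fun_prop) (by fun_prop) hQ]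
  apply lintegral_congr_ae
  filter_upwards [ae_restrict_of_ae hpos] with x hx
  simp only [Pi.mul_apply]
  rw [← ENNReal.ofReal_mul (by positivity), Real.rpow_neg hx.le]
  congr 1
  have : 0 < w x ^ (p / (p - 1)) := Real.rpow_pos_of_pos hx _
  field_simp

lemma sig_fp {μ : Measure X} {w f : X → ℝ} (hw : Measurable w) (hf : Measurable f)
    (hpos : ∀ᵐ x ∂μ, 0 < w x) {p : ℝ} (hp : 1 < p) :
    ∫⁻ x, ENNReal.ofReal ((|f x| * w x ^ (p / (p - 1))) ^ p) ∂(sig μ p w) =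
      ∫⁻ x, ENNReal.ofReal (|f x| ^ p * w x ^ p) ∂μ := by
  have hp1 : p - 1 ≠ 0 := by linarith
  rw [sig, lintegral_withDensity_eq_lintegral_mul _ (by fun_prop) (by fun_prop)]
  apply lintegral_congr_ae
  filter_upwards [hpos] with x hx
  simp only [Pi.mul_apply]
  rw [← ENNReal.ofReal_mul (by positivity), Real.mul_rpow (abs_nonneg _) (by positivity),
    ← Real.rpow_mul hx.le, mul_left_comm, ← Real.rpow_add hx]
  congr 3
  field_simp
  ring

lemma holder_sig {μ : Measure X} {w f : X → ℝ} (hw : Measurable w) (hf : Measurable f)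
    (hw0 : ∀ x, 0 ≤ w x)
    (hpos : ∀ᵐ x ∂μ, 0 < w x) {p : ℝ} (hp : 1 < p) {Q : Set X} (hQ : MeasurableSet Q) :
    ∫⁻ x in Q, ENNReal.ofReal |f x| ∂μ ≤
      (∫⁻ x, ENNReal.ofReal (|f x| ^ p * w x ^ p) ∂μ) ^ (1 / p) * (sig μ p w Q) ^ (1 - 1 / p) := by
  rw [← sig_f hw hf hpos hQ (p := p), ← sig_fp hw hf hpos hp]
  have hc : p.HolderConjugate (p / (p - 1)) := Real.HolderConjugate.conjExponent hp
  have := ENNReal.lintegral_mul_le_Lp_mul_Lq ((sig μ p w).restrict Q) hc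
    (f := fun x => ENNReal.ofReal (|f x| * w x ^ (p / (p - 1)))) (g := fun _ => 1)
    (by fun_prop) (by fun_prop)
  simp only [Pi.mul_apply, mul_one, ENNReal.one_rpow, lintegral_const, one_mul,
    Measure.restrict_apply_univ] at this
  have e : 1 / (p / (p - 1)) = 1 - 1 / p := by
    have : p ≠ 0 := by linarith
    field_simp
  rw [e] at this
  refine this.trans ?_
  gcongr ?_ ^ _ * _
  refine (setLIntegral_le_lintegral _ _).trans (lintegral_mono fun x => ?_)
  rw [ENNReal.ofReal_rpow_of_nonneg (mul_nonneg (abs_nonneg _) (Real.rpow_nonneg (hw0 x) _))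
    (by linarith)]

theorem GridN.main (hG : GridN π) [Countable Z] {μ : Measure X} {V : ℤ → ℝ≥0∞} {b : ℝ≥0∞}
    (hb : 1 < b) (hbt : b ≠ ∞) (hV0 : ∀ k, V k ≠ 0) (hVt : ∀ k, V k ≠ ∞)
    (hVb : ∀ k, V k = b * V (k + 1)) (hμ : ∀ Q, μ (cell π Q) = V Q.1) {β : ℝ} (hβ : 0 < β)
    (hβ1 : β < 1) {p q : ℝ} (hp : 1 < p) (hpq : p < q) (hpqβ : 1 / p - 1 / q = β)
    {w f : X → ℝ} (hw : Measurable w) (hf : Measurable f) (hw0 : ∀ x, 0 ≤ w x)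
    (hpos : ∀ᵐ x ∂μ, 0 < w x) {B : ℤ × Z → ℝ≥0∞} {K : ℝ≥0∞} (hKt : K ≠ ∞)
    (hB : ∀ Q, ∀ t : ℝ, 0 < t → ENNReal.ofReal t * μ (cell π Q ∩ {x | t < w x ^ q}) ≤ B Q)
    (hK : ∀ Q, ((μ (cell π Q))⁻¹ * B Q) ^ (1 / q) *
      ((μ (cell π Q))⁻¹ * sig μ p w (cell π Q)) ^ (1 - 1 / p) ≤ K)
    (hfi : ∫⁻ x, ENNReal.ofReal |f x| ∂μ ≠ ∞) (N : ℤ) {t : ℝ≥0∞} (ht0 : t ≠ 0) (htt : t ≠ ∞) :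
    t ^ q * μ {x | t < ENNReal.ofReal (w x) * ⨆ (k : ℤ) (_ : k ≤ N),
        vv π μ V β (fun x => ENNReal.ofReal |f x|) (k, π k x)} ≤
      (2 * b) ^ q * (K ^ q * (∫⁻ x, ENNReal.ofReal (|f x| ^ p * w x ^ p) ∂μ) ^ ((q - p) / p) *
        (4 * 4 ^ (p / (p - 1) / q) * K ^ (p / (p - 1)) *
        (ENNReal.ofReal (p * 2 * (p - 1)⁻¹ * 2 ^ (p - 1)) *
          ∫⁻ x, ENNReal.ofReal (|f x| ^ p * w x ^ p) ∂μ))) := by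
  have hq : 0 < q := by linarith
  have hb0 : b ≠ 0 := (zero_lt_one.trans hb).ne'
  set F : X → ℝ≥0∞ := fun x => ENNReal.ofReal |f x| with hF
  set Np := ∫⁻ x, ENNReal.ofReal (|f x| ^ p * w x ^ p) ∂μ with hNp
  set σ := sig μ p w with hσ
  set v : ℤ × Z → ℝ≥0∞ := vv π μ V β F with hv
  set h : X → ℝ≥0∞ := fun x => ⨆ (k : ℤ) (_ : k ≤ N), v (k, π k x) with hh
  set a : ℝ≥0∞ := 2 * b with ha
  have ha0 : a ≠ 0 := mul_ne_zero (by norm_num) hb0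
  have hat : a ≠ ∞ := ENNReal.mul_ne_top (by norm_num) hbt
  have hba : b ≤ a := by
    rw [ha, two_mul]; exact le_self_add
  have ha1 : 1 < a := hb.trans_le hba
  set g : X → ℝ := fun x => |f x| * w x ^ (p / (p - 1)) with hg
  have hgm : Measurable g := by fun_prop
  have hg0 : ∀ x, 0 ≤ g x := fun x => mul_nonneg (abs_nonneg _) (Real.rpow_nonneg (hw0 x) _)
  set M : X → ℝ≥0∞ := fun x => ⨆ k, avg π σ (fun y => ENNReal.ofReal (g y)) k x with hM
  have hmc : ∀ Q, MeasurableSet (cell π Q) := fun Q => hG.meas _ _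
  have hμ0 : ∀ Q, μ (cell π Q) ≠ 0 := fun Q => by rw [hμ]; exact hV0 _
  have hμt : ∀ Q, μ (cell π Q) ≠ ∞ := fun Q => by rw [hμ]; exact hVt _
  have hnd : ∀ Q, B Q ≠ 0 ∧ B Q ≠ ∞ ∧ σ (cell π Q) ≠ 0 ∧ σ (cell π Q) ≠ ∞ := fun Q =>
    cube_nondeg hw hpos hp hq (hmc Q) (hμ0 Q) (hμt Q) hKt (hB Q) (hK Q)
  have hstrong : ∫⁻ x, (M x) ^ p ∂σ ≤
      ENNReal.ofReal (p * 2 * (p - 1)⁻¹ * 2 ^ (p - 1)) * Np := by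
    have := hG.strong σ (fun k z _ => (hnd (k, z)).2.2.1) (fun k z => (hnd (k, z)).2.2.2) g hgm hg0 p hp
    rwa [hσ, sig_fp hw hf hpos hp] at this
  -- measurability of h
  have hvm : ∀ k, Measurable fun x => v (k, π k x) := by
    intro k
    let _ : MeasurableSpace Z := ⊤
    have h1 : Measurable (π k) := measurable_to_countable' fun z => hG.meas k z
    exact (measurable_from_top (f := fun z : Z => v (k, z))).comp h1
  have hhm : Measurable h := Measurable.iSup fun k => Measurable.iSup fun _ => hvm k
  -- bounds on v
  have hvle : ∀ Q, v Q ≤ V Q.1 ^ β * ((V Q.1)⁻¹ * ∫⁻ x, F x ∂μ) := by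
    intro Q
    rw [hv, vv]
    gcongr
    exact Measure.restrict_le_self
  have hhfin : ∀ x, h x ≠ ∞ := by
    intro x
    have h1 : h x ≤ (V N ^ (1 - β))⁻¹ * ∫⁻ x, F x ∂μ := by
      refine iSup₂_le fun k hk => (hvle _).trans ?_
      have e : V k ^ β * (V k)⁻¹ = (V k ^ (1 - β))⁻¹ := by
        rw [← ENNReal.rpow_neg, ← ENNReal.rpow_neg_one, ← ENNReal.rpow_add _ _ (hV0 k) (hVt k)]
        congr 1; ring
      simp only
      rw [← mul_assoc, e]
      have := V_anti hb hVb hk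
      gcongr
    refine ne_top_of_le_ne_top (ENNReal.mul_ne_top (ENNReal.inv_ne_top.2 ?_) hfi) h1
    exact (ENNReal.rpow_pos (pos_iff_ne_zero.2 (hV0 N)) (hVt N)).ne'
  let S : Set (ℤ × (ℤ × Z)) := {i | i.2.1 ≤ N ∧ a ^ i.1 < v i.2 ∧ (cell π i.2).Nonempty ∧
    ∀ x ∈ cell π i.2, ∀ k < i.2.1, v (k, π k x) ≤ a ^ i.1}
  let E : ℤ × (ℤ × Z) → Set X := fun i => cell π i.2 ∩ {x | h x ≤ a ^ (i.1 + 1)}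
  have hEm : ∀ i, MeasurableSet (E i) := fun i =>
    (hmc _).inter (measurableSet_le hhm measurable_const)
  have hEd : S.PairwiseDisjoint E := by
    rintro ⟨j, Q⟩ hi ⟨l, R⟩ hl hne
    rw [Function.onFun, Set.disjoint_left]
    rintro x ⟨hxQ, hx1⟩ ⟨hxR, hx2⟩
    obtain ⟨hi1, hi2, -, hi3⟩ := hi
    obtain ⟨hl1, hl2, -, hl3⟩ := hl
    simp only at hi1 hi2 hi3 hl1 hl2 hl3 hxQ hxR hx1 hx2
    have eQ : (Q.1, π Q.1 x) = Q := Prod.ext rfl (mem_cell.1 hxQ)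
    have eR : (R.1, π R.1 x) = R := Prod.ext rfl (mem_cell.1 hxR)
    have hQh : v Q ≤ h x := by
      have : v (Q.1, π Q.1 x) ≤ h x := le_iSup₂ (f := fun (k : ℤ) (_ : k ≤ N) => v (k, π k x)) Q.1 hi1
      rwa [eQ] at this
    have hRh : v R ≤ h x := by
      have : v (R.1, π R.1 x) ≤ h x := le_iSup₂ (f := fun (k : ℤ) (_ : k ≤ N) => v (k, π k x)) R.1 hl1
      rwa [eR] at this
    have hjl : j = l := by
      by_contra hjl
      rcases lt_or_gt_of_ne hjl with hlt | hlt
      · have h3 : a ^ (j + 1) ≤ a ^ l := ENNReal.zpow_le_of_le ha1.le (by omega)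
        exact absurd (hl2.trans_le (hRh.trans (hx1.trans h3))) (lt_irrefl _)
      · have h3 : a ^ (l + 1) ≤ a ^ j := ENNReal.zpow_le_of_le ha1.le (by omega)
        exact absurd (hi2.trans_le (hQh.trans (hx2.trans h3))) (lt_irrefl _)
    subst hjl
    rcases lt_trichotomy Q.1 R.1 with hlt | heq | hlt
    · have := hl3 x hxR Q.1 hlt
      rw [eQ] at this
      exact absurd (hi2.trans_le this) (lt_irrefl _)
    · apply hne
      rw [← eQ, ← eR, heq]
    · have := hi3 x hxQ R.1 hlt
      rw [eR] at this
      exact absurd (hl2.trans_le this) (lt_irrefl _)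
  set A : Set X := {x | t < ENNReal.ofReal (w x) * h x} with hA
  have hcov : A ⊆ ⋃ i ∈ S, (E i ∩ A) := by
    intro x hx
    have hx' : t < ENNReal.ofReal (w x) * h x := hx
    have hx0 : h x ≠ 0 := by
      intro h0
      rw [h0, mul_zero] at hx'
      exact not_lt_bot hx'
    obtain ⟨j, hj1, hj2⟩ := ENNReal.exists_mem_Ioc_zpow hx0 (hhfin x) ha1 hat
    have hex : ∃ k, k ≤ N ∧ a ^ j < v (k, π k x) := by
      have : a ^ j < ⨆ (k : ℤ) (_ : k ≤ N), v (k, π k x) := hj1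
      simp only [lt_iSup_iff] at this
      obtain ⟨k, hk, hk'⟩ := this
      exact ⟨k, hk, hk'⟩
    obtain ⟨k0, hk0⟩ := vv_small hb hV0 hVt hVb hβ1 hfi (ENNReal.zpow_pos ha0 hat j).ne'
    obtain ⟨k, ⟨hkN, hk⟩, hmin⟩ := Int.exists_least_of_bdd (P := fun k => k ≤ N ∧ a ^ j < v (k, π k x))
      ⟨k0, fun z hz => by
        by_contra hlt
        exact absurd (hz.2.trans_le ((hvle _).trans (hk0 z (by omega)))) (lt_irrefl _)⟩ hex
    simp only [mem_iUnion]
    refine ⟨(j, (k, π k x)), ⟨hkN, hk, ⟨x, rfl⟩, ?_⟩, ⟨rfl, hj2⟩, hx⟩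
    intro y hy l hl
    have hly : π l y = π l x := hG.nest_le (le_of_lt hl) hy
    simp only at hl ⊢
    rw [hly]
    by_contra hlt
    exact absurd (hmin l ⟨by omega, not_le.1 hlt⟩) (by omega)
  set C1 := K ^ q * Np ^ ((q - p) / p) with hC1
  set C2 := 4 * 4 ^ (p / (p - 1) / q) * K ^ (p / (p - 1)) with hC2
  have hpiece : ∀ i ∈ S, t ^ q * μ (E i ∩ A) ≤ a ^ q * (C1 * (C2 * ∫⁻ x in E i, (M x) ^ p ∂σ)) := by
    rintro ⟨j, Q⟩ ⟨hi1, hi2, ⟨x0, hx0⟩, hi3⟩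
    simp only at hi1 hi2 hi3 hx0
    have eQ : (Q.1, π Q.1 x0) = Q := Prod.ext rfl (mem_cell.1 hx0)
    have haj0 : a ^ j ≠ 0 := (ENNReal.zpow_pos ha0 hat j).ne'
    have hajt : a ^ j ≠ ∞ := ENNReal.zpow_ne_top ha0 hat j
    have haj1 : a ^ (j + 1) = 2 * b * a ^ j := by
      rw [ENNReal.zpow_add ha0 hat, zpow_one, mul_comm]
    have hvb : v Q ≤ b * a ^ j := by
      have h1 := hG.vv_parent hb hbt hVb hβ F (Q.1 - 1) x0 (μ := μ)
      rw [sub_add_cancel, eQ] at h1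
      refine h1.trans ?_
      gcongr
      exact hi3 x0 hx0 _ (by omega)
    have hI : ∫⁻ y in cell π Q, F y ∂μ ≠ ∞ := ne_top_of_le_ne_top hfi (setLIntegral_le_lintegral _ _)
    have hI0 : ∫⁻ y in cell π Q, F y ∂μ ≠ 0 := by
      intro h0
      have : v Q = 0 := by rw [hv, vv, h0]; simp
      rw [this] at hi2
      exact not_lt_bot hi2
    have hv0 : v Q ≠ 0 := (pos_iff_ne_zero.1 ((pos_iff_ne_zero.2 haj0).trans hi2))
    have hvt : v Q ≠ ∞ := ne_top_of_le_ne_top (ENNReal.mul_ne_top hbt hajt) hvb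
    -- sparse
    have hsp : μ (cell π Q \ E (j, Q)) ≤ 2⁻¹ * μ (cell π Q) := by
      refine le_trans (measure_mono ?_) (hG.sparse hb hbt hV0 hVt hVb hμ hβ haj0 hajt Q hvb)
      rintro x ⟨hxQ, hxE⟩
      refine ⟨hxQ, ?_⟩
      have hlt : a ^ (j + 1) < h x := by
        by_contra hle
        exact hxE ⟨hxQ, not_lt.1 hle⟩
      have : a ^ (j + 1) < ⨆ (k : ℤ) (_ : k ≤ N), v (k, π k x) := hlt
      simp only [lt_iSup_iff] at this
      obtain ⟨k, hk, hk'⟩ := this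
      refine ⟨k, ?_, haj1 ▸ hk'⟩
      by_contra hlt
      have h4 := hi3 x hxQ k (by omega)
      have h5 : a ^ j ≤ a ^ (j + 1) := ENNReal.zpow_le_of_le ha1.le (by omega)
      exact absurd (hk'.trans_le (h4.trans h5)) (lt_irrefl _)
    have hsE : σ (cell π Q) ≤ C2 * σ (E (j, Q)) :=
      cube_sparse hw hpos hp hq (hmc Q) (hμ0 Q) (hμt Q) hKt (hB Q) (hK Q) (hEm _) hsp
    -- weak estimate
    have hweak : t ^ q * μ (E (j, Q) ∩ A) ≤ (a * v Q) ^ q * B Q := by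
      set u := a * v Q with hu
      have hu0 : u ≠ 0 := mul_ne_zero ha0 hv0
      have hut : u ≠ ∞ := ENNReal.mul_ne_top hat hvt
      have htu0 : (t * u⁻¹) ^ q ≠ 0 := (ENNReal.rpow_pos (pos_iff_ne_zero.2
        (mul_ne_zero ht0 (ENNReal.inv_ne_zero.2 hut))) (ENNReal.mul_ne_top htt (ENNReal.inv_ne_top.2 hu0))).ne'
      have htut : (t * u⁻¹) ^ q ≠ ∞ := ENNReal.rpow_ne_top_of_nonneg hq.le
        (ENNReal.mul_ne_top htt (ENNReal.inv_ne_top.2 hu0))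
      have h1 := hB Q ((t * u⁻¹) ^ q).toReal (ENNReal.toReal_pos htu0 htut)
      rw [ENNReal.ofReal_toReal htut] at h1
      have hsub : E (j, Q) ∩ A ⊆ cell π Q ∩ {x | ((t * u⁻¹) ^ q).toReal < w x ^ q} := by
        rintro x ⟨⟨hxQ, hxh⟩, hxA⟩
        refine ⟨hxQ, ?_⟩
        have h2 : t < ENNReal.ofReal (w x) * u := by
          refine lt_of_lt_of_le hxA ?_
          gcongr
          refine le_trans hxh ?_
          simp only
          rw [haj1, hu]
          gcongr
        have h3 : t * u⁻¹ < ENNReal.ofReal (w x) := by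
          rw [← div_eq_mul_inv]
          exact (ENNReal.div_lt_iff (Or.inl hu0) (Or.inl hut)).2 h2
        have h4 := ENNReal.rpow_lt_rpow h3 hq
        rw [ENNReal.ofReal_rpow_of_nonneg (hw0 x) hq.le] at h4
        exact (ENNReal.lt_ofReal_iff_toReal_lt htut).1 h4
      calc t ^ q * μ (E (j, Q) ∩ A) = u ^ q * ((t * u⁻¹) ^ q * μ (E (j, Q) ∩ A)) := by
            rw [← mul_assoc, ← ENNReal.mul_rpow_of_nonneg _ _ hq.le]
            rw [mul_comm t, ← mul_assoc, ENNReal.mul_inv_cancel hu0 hut, one_mul]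
        _ ≤ u ^ q * ((t * u⁻¹) ^ q * μ (cell π Q ∩ {x | ((t * u⁻¹) ^ q).toReal < w x ^ q})) := by
            gcongr
        _ ≤ _ := by gcongr
    have halg : v Q ^ q * B Q ≤ C1 * (((σ (cell π Q))⁻¹ * ∫⁻ y in cell π Q, F y ∂μ) ^ p * σ (cell π Q)) := by
      have hKQ := hK Q
      rw [hμ] at hKQ
      exact cube_algebra (hV0 _) (hVt _) (hnd Q).2.2.1 (hnd Q).2.2.2 hI0 hI hp hpq hpqβ hKQ
        (holder_sig hw hf hw0 hpos hp (hmc Q))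
    have hintegral : ((σ (cell π Q))⁻¹ * ∫⁻ y in cell π Q, F y ∂μ) ^ p * σ (E (j, Q)) ≤
        ∫⁻ x in E (j, Q), (M x) ^ p ∂σ := by
      rw [← setLIntegral_const]
      refine setLIntegral_mono' (hEm _) ?_
      rintro x ⟨hxQ, -⟩
      refine ENNReal.rpow_le_rpow ?_ (by linarith)
      refine le_trans (le_of_eq ?_) (le_iSup _ Q.1)
      have e : π Q.1 ⁻¹' {π Q.1 x} = cell π Q := by rw [mem_cell.1 hxQ]; rfl
      rw [avg, e, hσ, hg, sig_f hw hf hpos (hmc Q)]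
    calc t ^ q * μ (E (j, Q) ∩ A) ≤ (a * v Q) ^ q * B Q := hweak
      _ = a ^ q * (v Q ^ q * B Q) := by rw [ENNReal.mul_rpow_of_nonneg _ _ hq.le, mul_assoc]
      _ ≤ a ^ q * (C1 * (((σ (cell π Q))⁻¹ * ∫⁻ y in cell π Q, F y ∂μ) ^ p *
          (C2 * σ (E (j, Q))))) := by
          refine mul_le_mul_right (halg.trans ?_) _
          gcongr
      _ = a ^ q * (C1 * (C2 * (((σ (cell π Q))⁻¹ * ∫⁻ y in cell π Q, F y ∂μ) ^ p *
          σ (E (j, Q))))) := by ring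
      _ ≤ _ := by gcongr
  calc t ^ q * μ A ≤ t ^ q * ∑' i : S, μ (E i ∩ A) := by
        gcongr
        exact (measure_mono hcov).trans (measure_biUnion_le _ (Set.to_countable S) _)
    _ = ∑' i : S, t ^ q * μ (E i ∩ A) := ENNReal.tsum_mul_left.symm
    _ ≤ ∑' i : S, a ^ q * (C1 * (C2 * ∫⁻ x in E i, (M x) ^ p ∂σ)) :=
        ENNReal.tsum_le_tsum fun i => hpiece i i.2
    _ = a ^ q * (C1 * (C2 * ∑' i : S, ∫⁻ x in E i, (M x) ^ p ∂σ)) := by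
        simp_rw [ENNReal.tsum_mul_left]
    _ = a ^ q * (C1 * (C2 * ∫⁻ x in ⋃ i ∈ S, E i, (M x) ^ p ∂σ)) := by
        rw [lintegral_biUnion (Set.to_countable S) (fun i _ => hEm i) hEd]
    _ ≤ a ^ q * (C1 * (C2 * ∫⁻ x, (M x) ^ p ∂σ)) := by
        gcongr
        exact Measure.restrict_le_self
    _ ≤ _ := by gcongr

end DyadicMain
section Concrete

/-- offset of the shifted dyadic grid. -/
def goff (s : Bool) (k : ℤ) : ℝ := if s then (-1 : ℝ) ^ k / 3 else 0

/-- index map of the (shifted) dyadic grids. -/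
def gp (n : ℕ) (s : Fin n → Bool) (k : ℤ) (x : Fin n → ℝ) : Fin n → ℤ :=
  fun i => ⌊(2 : ℝ) ^ k * x i - goff (s i) k⌋

/-- lower corner of cells. -/
def gcor (n : ℕ) (s : Fin n → Bool) (Q : ℤ × (Fin n → ℤ)) : Fin n → ℝ :=
  fun i => (Q.2 i + goff (s i) Q.1) / 2 ^ Q.1

lemma neg_one_zpow_cases (k : ℤ) : (-1 : ℝ) ^ k = 1 ∨ (-1 : ℝ) ^ k = -1 := by
  rcases Int.even_or_odd k with h | h
  · left; exact h.neg_one_zpow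
  · right; exact h.neg_one_zpow

lemma cell_gp (n : ℕ) (s : Fin n → Bool) (Q : ℤ × (Fin n → ℤ)) :
    cell (gp n s) Q = Set.univ.pi fun i => Set.Ico (gcor n s Q i) (gcor n s Q i + ((2 : ℝ) ^ Q.1)⁻¹) := by
  ext x
  have h2 : (0 : ℝ) < 2 ^ Q.1 := by positivity
  simp only [mem_cell, Set.mem_pi, mem_univ, true_implies, funext_iff, gp, gcor, Int.floor_eq_iff, mem_Ico]
  refine forall_congr' fun i => ?_
  rw [div_le_iff₀ h2, show (Q.2 i + goff (s i) Q.1) / (2 : ℝ) ^ Q.1 + ((2 : ℝ) ^ Q.1)⁻¹ =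
    (Q.2 i + goff (s i) Q.1 + 1) / (2 : ℝ) ^ Q.1 by field_simp, lt_div_iff₀ h2]
  constructor
  · rintro ⟨h, h'⟩; constructor <;> linarith
  · rintro ⟨h, h'⟩; constructor <;> linarith

lemma gp_nest_one (s : Bool) (k : ℤ) (x y : ℝ)
    (h : ⌊(2 : ℝ) ^ (k + 1) * x - goff s (k + 1)⌋ = ⌊(2 : ℝ) ^ (k + 1) * y - goff s (k + 1)⌋) :
    ⌊(2 : ℝ) ^ k * x - goff s k⌋ = ⌊(2 : ℝ) ^ k * y - goff s k⌋ := by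
  obtain ⟨e, he⟩ : ∃ e : ℤ, ∀ x : ℝ, (2 : ℝ) ^ k * x - goff s k =
      ((2 : ℝ) ^ (k + 1) * x - goff s (k + 1) - e) / 2 := by
    cases s
    · refine ⟨0, fun x => ?_⟩
      simp only [goff, zpow_add₀ (two_ne_zero' ℝ)]
      simp
      ring
    · have e1 : (-1 : ℝ) ^ (k + 1) = - (-1 : ℝ) ^ k := by
        rw [zpow_add₀ (by norm_num)]; simp
      rcases neg_one_zpow_cases k with h | h
      · refine ⟨1, fun x => ?_⟩
        simp only [goff, zpow_add₀ (two_ne_zero' ℝ), e1, h]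
        simp
        ring
      · refine ⟨-1, fun x => ?_⟩
        simp only [goff, zpow_add₀ (two_ne_zero' ℝ), e1, h]
        simp
        ring
  have key : ∀ u : ℝ, ⌊(u - e) / 2⌋ = (⌊u⌋ - e) / 2 := by
    intro u
    have := Int.floor_div_natCast (u - e) 2
    rw [Int.floor_sub_intCast] at this
    exact_mod_cast this
  rw [he, he, key, key, h]

lemma gp_grid (n : ℕ) (s : Fin n → Bool) : GridN (gp n s) where
  meas k z := by
    have := cell_gp n s (k, z)
    rw [cell] at this
    rw [this]
    exact MeasurableSet.univ_pi fun i => measurableSet_Ico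
  nest k x y h := by
    funext i
    exact gp_nest_one (s i) k (x i) (y i) (congrFun h i)

/-- volume of cells. -/
def gV (n : ℕ) (k : ℤ) : ℝ≥0∞ := ENNReal.ofReal ((2 : ℝ) ^ k)⁻¹ ^ n

lemma gV_ne_zero (n : ℕ) (k : ℤ) : gV n k ≠ 0 := by
  apply pow_ne_zero
  rw [Ne, ENNReal.ofReal_eq_zero, not_le]; positivity

lemma gV_ne_top (n : ℕ) (k : ℤ) : gV n k ≠ ∞ := ENNReal.pow_ne_top ENNReal.ofReal_ne_top

lemma gV_succ (n : ℕ) (k : ℤ) : gV n k = 2 ^ n * gV n (k + 1) := by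
  rw [gV, gV, ← mul_pow]
  congr 1
  rw [show (2 : ℝ≥0∞) = ENNReal.ofReal 2 by simp, ← ENNReal.ofReal_mul (by norm_num),
    zpow_add₀ (by norm_num)]
  congr 1
  have : (0 : ℝ) < 2 ^ k := by positivity
  field_simp

lemma vol_cell (n : ℕ) (s : Fin n → Bool) (Q : ℤ × (Fin n → ℤ)) :
    volume (cell (gp n s) Q) = gV n Q.1 := by
  rw [cell_gp, Real.volume_pi_Ico (b := fun i => gcor n s Q i + ((2 : ℝ) ^ Q.1)⁻¹)]
  simp [gV]

lemma vol_cube (n : ℕ) (a : Fin n → ℝ) (h : ℝ) :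
    volume (Set.univ.pi fun i => Set.Icc (a i) (a i + h)) = ENNReal.ofReal h ^ n := by
  rw [volume_pi_pi]
  simp

lemma third_one (k : ℤ) (a l : ℝ) (hl : 0 < l) (hk : (2 : ℝ) ^ k * l < 1 / 3) :
    ∃ s : Bool, ∀ y ∈ Icc a (a + l), ∀ x ∈ Icc a (a + l),
      ⌊(2 : ℝ) ^ k * y - goff s k⌋ = ⌊(2 : ℝ) ^ k * x - goff s k⌋ := by
  have h2 : (0 : ℝ) < 2 ^ k := by positivity
  set P : ℝ := 2 ^ k with hP
  have hb : ∀ y ∈ Icc a (a + l), P * a ≤ P * y ∧ P * y ≤ P * a + P * l := by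
    rintro y ⟨h, h'⟩
    exact ⟨by gcongr, by rw [← mul_add]; gcongr⟩
  by_cases hc : P * a + P * l < ⌊P * a⌋ + 1
  · refine ⟨false, ?_⟩
    have : ∀ y ∈ Icc a (a + l), ⌊P * y - goff false k⌋ = ⌊P * a⌋ := by
      intro y hy
      obtain ⟨h, h'⟩ := hb y hy
      rw [Int.floor_eq_iff]
      simp only [goff]
      have := Int.floor_le (P * a)
      constructor
      · simp; linarith
      · simp; linarith
    intro y hy x hx
    rw [this y hy, this x hx]
  · refine ⟨true, ?_⟩
    push Not at hc
    have hf := Int.lt_floor_add_one (P * a)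
    rcases neg_one_zpow_cases k with he | he
    · have : ∀ y ∈ Icc a (a + l), ⌊P * y - goff true k⌋ = ⌊P * a⌋ := by
        intro y hy
        obtain ⟨h, h'⟩ := hb y hy
        rw [Int.floor_eq_iff]
        simp only [goff, he, if_true]
        constructor <;> linarith
      intro y hy x hx
      rw [this y hy, this x hx]
    · have : ∀ y ∈ Icc a (a + l), ⌊P * y - goff true k⌋ = ⌊P * a⌋ + 1 := by
        intro y hy
        obtain ⟨h, h'⟩ := hb y hy
        rw [Int.floor_eq_iff]
        simp only [goff, he, if_true]
        push_cast
        constructor <;> linarith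
      intro y hy x hx
      rw [this y hy, this x hx]

lemma third (n : ℕ) (a : Fin n → ℝ) (l : ℝ) (hl : 0 < l) (x : Fin n → ℝ)
    (hx : x ∈ Set.univ.pi fun i => Set.Icc (a i) (a i + l)) :
    ∃ (s : Fin n → Bool) (k : ℤ), (Set.univ.pi fun i => Set.Icc (a i) (a i + l)) ⊆
      cell (gp n s) (k, gp n s k x) ∧ l ≤ ((2 : ℝ) ^ k)⁻¹ ∧ ((2 : ℝ) ^ k)⁻¹ ≤ 6 * l := by
  obtain ⟨m, hm1, hm2⟩ := exists_mem_Ico_zpow (show (0 : ℝ) < 3 * l by positivity) one_lt_two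
  have hk2 : (2 : ℝ) ^ (-(m + 1)) * l < 1 / 3 := by
    rw [zpow_neg, inv_mul_lt_iff₀ (by positivity)]
    linarith
  choose s hs using fun i => third_one (-(m + 1)) (a i) l hl hk2
  refine ⟨s, -(m + 1), ?_, ?_, ?_⟩
  · intro y hy
    rw [mem_cell]
    funext i
    exact hs i (y i) (hy i trivial) (x i) (hx i trivial)
  · rw [zpow_neg, inv_inv]; linarith
  · rw [zpow_neg, inv_inv, zpow_add₀ (by norm_num)]
    rw [zpow_one]; linarith

/-- pointwise domination of the fractional maximal function by dyadic ones -/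
lemma frac_le (n : ℕ) {β : ℝ} (hβ : 0 < β) (F : (Fin n → ℝ) → ℝ≥0∞) (a : Fin n → ℝ) (l : ℝ)
    (hl : 0 < l) (x : Fin n → ℝ) {Q : Set (Fin n → ℝ)}
    (hQ : Q = Set.univ.pi fun i => Set.Icc (a i) (a i + l)) (hx : x ∈ Q) :
    ∃ (s : Fin n → Bool) (k : ℤ), volume Q ^ β * ((volume Q)⁻¹ * ∫⁻ y in Q, F y) ≤
      6 ^ n * vv (gp n s) volume (gV n) β F (k, gp n s k x) := by
  subst hQ
  obtain ⟨s, k, hsub, h1, h2⟩ := third n a l hl x hx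
  refine ⟨s, k, ?_⟩
  rw [vol_cube]
  have hle : ENNReal.ofReal l ^ n ≤ gV n k := by
    rw [gV]; gcongr
  have hge : (ENNReal.ofReal l ^ n)⁻¹ ≤ 6 ^ n * (gV n k)⁻¹ := by
    have h3 : gV n k ≤ 6 ^ n * ENNReal.ofReal l ^ n := by
      rw [gV, ← mul_pow]
      gcongr
      rw [show (6 : ℝ≥0∞) = ENNReal.ofReal 6 by simp, ← ENNReal.ofReal_mul (by norm_num)]
      exact ENNReal.ofReal_le_ofReal h2
    have h60 : (6 : ℝ≥0∞) ^ n ≠ 0 := by positivity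
    have h6t : (6 : ℝ≥0∞) ^ n ≠ ∞ := ENNReal.pow_ne_top (by norm_num)
    calc (ENNReal.ofReal l ^ n)⁻¹ = 6 ^ n * (6 ^ n * ENNReal.ofReal l ^ n)⁻¹ := by
          rw [ENNReal.mul_inv (Or.inl h60) (Or.inl h6t), ← mul_assoc, ENNReal.mul_inv_cancel h60 h6t, one_mul]
      _ ≤ _ := by
          gcongr
  calc _ ≤ gV n k ^ β * ((6 ^ n * (gV n k)⁻¹) * ∫⁻ y in cell (gp n s) (k, gp n s k x), F y) := by
        gcongr
    _ = _ := by rw [vv]; ring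

lemma wnorm_mono {n : ℕ} {r : ℝ} (hr : 0 < r) {g h : (Fin n → ℝ) → ℝ≥0∞} (hgh : ∀ x, g x ≤ h x) :
    wnormE n r g ≤ wnormE n r h := by
  unfold wnormE
  refine iSup₂_mono fun t ht => ?_
  gcongr ENNReal.ofReal t * ?_ ^ _
  exact measure_mono fun x hx => lt_of_lt_of_le hx (hgh x)

lemma wnorm_ge {n : ℕ} {q : ℝ} (Q : Set (Fin n → ℝ)) (w : (Fin n → ℝ) → ℝ) (t : ℝ) (ht : 0 < t) :
    ENNReal.ofReal t * volume (Q ∩ {x | t < w x ^ q}) ≤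
      wnormE n 1 (Q.indicator fun x => ENNReal.ofReal (w x ^ q)) := by
  unfold wnormE
  refine le_trans ?_ (le_iSup₂ (f := fun (t : ℝ) (_ : 0 < t) => ENNReal.ofReal t *
    volume {x | ENNReal.ofReal t < Q.indicator (fun x => ENNReal.ofReal (w x ^ q)) x} ^ (1 / (1 : ℝ))) t ht)
  rw [div_one, ENNReal.rpow_one]
  gcongr
  rintro x ⟨hx, hx'⟩
  simp only [mem_ofPred_eq, indicator_of_mem hx] at hx' ⊢
  exact (ENNReal.ofReal_lt_ofReal_iff (ht.trans hx')).2 hx'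

end Concrete

lemma gp_hK (n : ℕ) (s : Fin n → Bool) {p q : ℝ} (hp : 1 < p) (hq : 0 < q) (w : (Fin n → ℝ) → ℝ)
    (Q : ℤ × (Fin n → ℤ)) :
    ((volume (cell (gp n s) Q))⁻¹ *
      wnormE n 1 ((cell (gp n s) Q).indicator fun x => ENNReal.ofReal (w x ^ q))) ^ (1 / q) *
      ((volume (cell (gp n s) Q))⁻¹ * sig volume p w (cell (gp n s) Q)) ^ (1 - 1 / p) ≤
      ApqStarConst n p q w := by
  have hr : 0 ≤ 1 - 1 / p := by
    have : 1 / p < 1 := by rw [div_lt_one (by linarith)]; exact hp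
    linarith
  have h2 : (0 : ℝ) < (2 ^ Q.1)⁻¹ := by positivity
  have hms : MeasurableSet (cell (gp n s) Q) := by
    rw [cell_gp]
    exact MeasurableSet.univ_pi fun i => measurableSet_Ico
  set D : Set (Fin n → ℝ) := Set.univ.pi fun i => Set.Icc (gcor n s Q i)
    (gcor n s Q i + ((2 : ℝ) ^ Q.1)⁻¹) with hD
  have hsub : cell (gp n s) Q ⊆ D := by
    rw [cell_gp]
    exact Set.pi_mono fun i _ => Ico_subset_Icc_self
  have hvol : volume (cell (gp n s) Q) = volume D := by
    rw [vol_cell, hD, vol_cube, gV]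
  have hc : IsCube n D := ⟨_, _, h2, rfl⟩
  refine le_trans ?_ (le_iSup₂ (f := fun (Q : Set (Fin n → ℝ)) (_ : IsCube n Q) =>
    ((volume Q)⁻¹ * wnormE n 1 (Q.indicator fun x => ENNReal.ofReal (w x ^ q))) ^ (1 / q) *
      ((volume Q)⁻¹ * ∫⁻ x in Q, ENNReal.ofReal (w x ^ (-(p / (p - 1))))) ^ (1 - 1 / p)) D hc)
  rw [hvol, sig, withDensity_apply _ hms]
  refine mul_le_mul' (ENNReal.rpow_le_rpow (mul_le_mul' le_rfl ?_) (by positivity))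
    (ENNReal.rpow_le_rpow (mul_le_mul' le_rfl ?_) hr)
  · exact wnorm_mono one_pos fun x => indicator_le_indicator_of_subset hsub (fun _ => zero_le) x
  · exact lintegral_mono_set hsub

lemma int_cube (n : ℕ) {p q : ℝ} (hp : 1 < p) (hq : 0 < q) {w f : (Fin n → ℝ) → ℝ}
    (hw : Measurable w) (hf : Measurable f) (hw0 : ∀ x, 0 ≤ w x)
    (hpos : ∀ᵐ x ∂(volume : Measure (Fin n → ℝ)), 0 < w x) (hK : ApqStarConst n p q w ≠ ∞)
    (hN : (∫⁻ x, ENNReal.ofReal (|f x| ^ p * w x ^ p)) ≠ ∞) {D : Set (Fin n → ℝ)}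
    (hD : IsCube n D) : ∫⁻ x in D, ENNReal.ofReal |f x| ≠ ∞ := by
  have hr : 0 ≤ 1 - 1 / p := by
    have : 1 / p < 1 := by rw [div_lt_one (by linarith)]; exact hp
    linarith
  have hms : MeasurableSet D := by
    obtain ⟨a, h, -, rfl⟩ := hD
    exact MeasurableSet.univ_pi fun i => measurableSet_Icc
  have hv : volume D ≠ 0 ∧ volume D ≠ ∞ := by
    obtain ⟨a, h, h0, rfl⟩ := hD
    rw [vol_cube]
    refine ⟨pow_ne_zero _ ?_, ENNReal.pow_ne_top ENNReal.ofReal_ne_top⟩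
    rw [Ne, ENNReal.ofReal_eq_zero, not_le]; exact h0
  have hKD := le_iSup₂ (f := fun (Q : Set (Fin n → ℝ)) (_ : IsCube n Q) =>
    ((volume Q)⁻¹ * wnormE n 1 (Q.indicator fun x => ENNReal.ofReal (w x ^ q))) ^ (1 / q) *
      ((volume Q)⁻¹ * ∫⁻ x in Q, ENNReal.ofReal (w x ^ (-(p / (p - 1))))) ^ (1 - 1 / p)) D hD
  have hs : sig volume p w D = ∫⁻ x in D, ENNReal.ofReal (w x ^ (-(p / (p - 1)))) := by
    rw [sig, withDensity_apply _ hms]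
  have h := cube_nondeg hw hpos hp hq hms hv.1 hv.2 hK (fun t ht => wnorm_ge D w t ht)
    (by rw [hs]; exact hKD)
  refine ne_top_of_le_ne_top ?_ (holder_sig hw hf hw0 hpos hp hms)
  exact ENNReal.mul_ne_top (ENNReal.rpow_ne_top_of_nonneg (by positivity) hN)
    (ENNReal.rpow_ne_top_of_nonneg hr h.2.2.2)

/-- Exhausting cubes. -/
def ecube (n : ℕ) (R : ℕ) : Set (Fin n → ℝ) :=
  Set.univ.pi fun _ => Set.Icc (-((R : ℝ) + 1)) (-((R : ℝ) + 1) + 2 * ((R : ℝ) + 1))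

lemma ecube_isCube (n R : ℕ) : IsCube n (ecube n R) :=
  ⟨fun _ => -((R : ℝ) + 1), 2 * ((R : ℝ) + 1), by positivity, rfl⟩

lemma ecube_meas (n R : ℕ) : MeasurableSet (ecube n R) :=
  MeasurableSet.univ_pi fun _ => measurableSet_Icc

lemma ecube_mono (n : ℕ) : Monotone (ecube n) := by
  intro R S h
  have : (R : ℝ) ≤ S := by exact_mod_cast h
  exact Set.pi_mono fun i _ => Icc_subset_Icc (by linarith) (by linarith)

lemma ecube_ex (n : ℕ) (x : Fin n → ℝ) : ∃ R, x ∈ ecube n R := by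
  obtain ⟨R, hR⟩ := exists_nat_ge ‖x‖
  refine ⟨R, fun i _ => ?_⟩
  have := (norm_le_pi_norm x i).trans hR
  rw [Real.norm_eq_abs, abs_le] at this
  constructor <;> linarith

lemma ecube_ind_mono (n : ℕ) (f : (Fin n → ℝ) → ℝ) (x : Fin n → ℝ) :
    Monotone fun R : ℕ => ENNReal.ofReal |(ecube n R).indicator f x| := by
  intro R S h
  apply ENNReal.ofReal_le_ofReal
  by_cases hx : x ∈ ecube n R
  · rw [indicator_of_mem hx, indicator_of_mem (ecube_mono n h hx)]
  · rw [indicator_of_notMem hx]; simp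

lemma ecube_ind_sup (n : ℕ) (f : (Fin n → ℝ) → ℝ) (x : Fin n → ℝ) :
    ⨆ R : ℕ, ENNReal.ofReal |(ecube n R).indicator f x| = ENNReal.ofReal |f x| := by
  apply le_antisymm
  · refine iSup_le fun R => ENNReal.ofReal_le_ofReal ?_
    by_cases hx : x ∈ ecube n R
    · rw [indicator_of_mem hx]
    · rw [indicator_of_notMem hx]; simp
  · obtain ⟨R, hR⟩ := ecube_ex n x
    refine le_trans ?_ (le_iSup _ R)
    rw [indicator_of_mem hR]

lemma vv_sup (n : ℕ) (s : Fin n → Bool) {β : ℝ} {f : (Fin n → ℝ) → ℝ} (hf : Measurable f)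
    (Q : ℤ × (Fin n → ℤ)) :
    vv (gp n s) volume (gV n) β (fun x => ENNReal.ofReal |f x|) Q =
      ⨆ R : ℕ, vv (gp n s) volume (gV n) β
        (fun x => ENNReal.ofReal |(ecube n R).indicator f x|) Q := by
  simp only [vv]
  rw [← ENNReal.mul_iSup, ← ENNReal.mul_iSup, ← lintegral_iSup]
  · simp only [ecube_ind_sup]
  · intro R
    exact (hf.indicator (ecube_meas n R)).abs.ennreal_ofReal
  · intro R S h x
    exact ecube_ind_mono n f x h

lemma vv_mono (n : ℕ) (s : Fin n → Bool) {β : ℝ} {f : (Fin n → ℝ) → ℝ}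
    (Q : ℤ × (Fin n → ℤ)) : Monotone fun R : ℕ => vv (gp n s) volume (gV n) β
        (fun x => ENNReal.ofReal |(ecube n R).indicator f x|) Q := by
  intro R S h
  simp only [vv]
  refine mul_le_mul' le_rfl (mul_le_mul' le_rfl (lintegral_mono fun x => ecube_ind_mono n f x h))

/-- Super-level sets for a single grid and truncation. -/
def levR (n : ℕ) (β : ℝ) (w f : (Fin n → ℝ) → ℝ) (t : ℝ≥0∞) (s : Fin n → Bool) (R : ℕ) :
    Set (Fin n → ℝ) :=
  {x | t < ENNReal.ofReal (w x) * ⨆ (k : ℤ) (_ : k ≤ (R : ℤ)),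
    vv (gp n s) volume (gV n) β (fun x => ENNReal.ofReal |(ecube n R).indicator f x|)
      (k, gp n s k x)}

lemma levR_mono (n : ℕ) (β : ℝ) (w f : (Fin n → ℝ) → ℝ) (t : ℝ≥0∞) (s : Fin n → Bool) :
    Monotone (levR n β w f t s) := by
  intro R S h x hx
  rw [levR, mem_ofPred_eq] at hx ⊢
  refine lt_of_lt_of_le hx (mul_le_mul' le_rfl ?_)
  refine iSup₂_le fun k hk => ?_
  have hk' : k ≤ (S : ℤ) := hk.trans (by exact_mod_cast h)
  exact (vv_mono n s (k, gp n s k x) h).trans (le_iSup₂ (f := fun (k : ℤ) (_ : k ≤ (S : ℤ)) =>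
    vv (gp n s) volume (gV n) β (fun x => ENNReal.ofReal |(ecube n S).indicator f x|)
      (k, gp n s k x)) k hk')

lemma lev_sub (n : ℕ) {α : ℝ} (hβ : 0 < α / (n : ℝ)) {w f : (Fin n → ℝ) → ℝ} (hf : Measurable f)
    (t : ℝ≥0∞) :
    {x | t < ENNReal.ofReal (w x) * fracMaximalFn n α f x} ⊆
      ⋃ s, ⋃ R, levR n (α / n) w f (t * (6 ^ n)⁻¹) s R := by
  intro x hx
  have h60 : (6 ^ n : ℝ≥0∞) ≠ 0 := by positivity
  have h6t : (6 ^ n : ℝ≥0∞) ≠ ∞ := ENNReal.pow_ne_top (by norm_num)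
  simp only [mem_ofPred_eq, fracMaximalFn, ENNReal.mul_iSup, lt_iSup_iff] at hx
  obtain ⟨Q, ⟨a, l, hl, hQ⟩, hxQ, hlt⟩ := hx
  obtain ⟨s, k, hle⟩ := frac_le n hβ (fun y => ENNReal.ofReal |f y|) a l hl x hQ hxQ
  have h1 := hlt.trans_le (mul_le_mul' le_rfl hle)
  rw [mul_left_comm, mul_comm, ← ENNReal.div_lt_iff (Or.inl h60) (Or.inl h6t), div_eq_mul_inv,
    vv_sup n s hf, ENNReal.mul_iSup, lt_iSup_iff] at h1
  obtain ⟨R, hR⟩ := h1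
  simp only [mem_iUnion]
  obtain ⟨S, hRS, hk'⟩ : ∃ S : ℕ, R ≤ S ∧ k ≤ (S : ℤ) := by
    refine ⟨max R k.toNat, le_max_left _ _, ?_⟩
    have := Int.self_le_toNat k
    push_cast
    exact this.trans (le_max_right _ _)
  refine ⟨s, S, ?_⟩
  rw [levR, mem_ofPred_eq]
  refine lt_of_lt_of_le hR (mul_le_mul' le_rfl ?_)
  exact (vv_mono n s (k, gp n s k x) hRS).trans
    (le_iSup₂ (f := fun (k : ℤ) (_ : k ≤ (S : ℤ)) =>
    vv (gp n s) volume (gV n) (α / n) (fun x => ENNReal.ofReal |(ecube n S).indicator f x|)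
      (k, gp n s k x)) k hk')

lemma levR_bound (n : ℕ) (hn : 1 ≤ n) {β : ℝ} (hβ : 0 < β) (hβ1 : β < 1) {p q : ℝ} (hp : 1 < p)
    (hpq : p < q) (hpqβ : 1 / p - 1 / q = β) {w f : (Fin n → ℝ) → ℝ} (hw : Measurable w)
    (hf : Measurable f) (hw0 : ∀ x, 0 ≤ w x)
    (hpos : ∀ᵐ x ∂(volume : Measure (Fin n → ℝ)), 0 < w x) (hK : ApqStarConst n p q w ≠ ∞)
    (hN : (∫⁻ x, ENNReal.ofReal (|f x| ^ p * w x ^ p)) ≠ ∞) {t : ℝ≥0∞} (ht0 : t ≠ 0) (htt : t ≠ ∞)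
    (s : Fin n → Bool) (R : ℕ) :
    t ^ q * volume (levR n β w f t s R) ≤ ((2 * 2 ^ n) ^ q * (4 * 4 ^ (p / (p - 1) / q) *
      ENNReal.ofReal (p * 2 * (p - 1)⁻¹ * 2 ^ (p - 1)))) *
      (ApqStarConst n p q w ^ (q + p / (p - 1)) *
      (∫⁻ x, ENNReal.ofReal (|f x| ^ p * w x ^ p)) ^ (q / p)) := by
  have hq : 0 < q := by linarith
  have hp0 : 0 < p := by linarith
  have hp1 : 0 < p - 1 := by linarith
  have hfR : Measurable ((ecube n R).indicator f) := hf.indicator (ecube_meas n R)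
  have hfi : ∫⁻ x, ENNReal.ofReal |(ecube n R).indicator f x| ≠ ∞ := by
    have := int_cube n hp hq hw hf hw0 hpos hK hN (ecube_isCube n R)
    rw [← lintegral_indicator (ecube_meas n R)] at this
    refine ne_top_of_le_ne_top this (lintegral_mono fun x => ?_)
    by_cases hx : x ∈ ecube n R
    · simp [hx]
    · simp [hx]
  have hNle : ∫⁻ x, ENNReal.ofReal (|(ecube n R).indicator f x| ^ p * w x ^ p) ≤
      ∫⁻ x, ENNReal.ofReal (|f x| ^ p * w x ^ p) := by
    refine lintegral_mono fun x => ?_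
    by_cases hx : x ∈ ecube n R
    · simp [hx]
    · simp [hx, Real.zero_rpow hp0.ne']
  have h2n : (1 : ℝ≥0∞) < 2 ^ n := one_lt_pow₀ (by norm_num) (by omega)
  have hmain := GridN.main (gp_grid n s) (μ := volume) (V := gV n) (b := 2 ^ n) h2n
    (ENNReal.pow_ne_top (by norm_num)) (gV_ne_zero n) (gV_ne_top n) (gV_succ n) (vol_cell n s)
    hβ hβ1 hp hpq hpqβ hw hfR hw0 hpos (K := ApqStarConst n p q w) hK
    (B := fun Q => wnormE n 1 ((cell (gp n s) Q).indicator fun x => ENNReal.ofReal (w x ^ q)))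
    (fun Q t ht => wnorm_ge _ w t ht) (gp_hK n s hp hq w) hfi R ht0 htt
  refine hmain.trans ?_
  set K := ApqStarConst n p q w
  set N := ∫⁻ x, ENNReal.ofReal (|f x| ^ p * w x ^ p)
  set N' := ∫⁻ x, ENNReal.ofReal (|(ecube n R).indicator f x| ^ p * w x ^ p)
  have e1 : K ^ (q + p / (p - 1)) = K ^ q * K ^ (p / (p - 1)) :=
    ENNReal.rpow_add_of_nonneg _ _ hq.le (by positivity)
  have e2 : N ^ (q / p) = N ^ ((q - p) / p) * N := by
    conv_rhs => rw [← ENNReal.rpow_one N, ← ENNReal.rpow_mul, one_mul]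
    rw [← ENNReal.rpow_add_of_nonneg _ _ (div_nonneg (by linarith) hp0.le) zero_le_one]
    congr 1
    field_simp
    ring
  rw [e1, e2]
  calc _ ≤ (2 * 2 ^ n) ^ q * (K ^ q * N ^ ((q - p) / p) *
        (4 * 4 ^ (p / (p - 1) / q) * K ^ (p / (p - 1)) *
        (ENNReal.ofReal (p * 2 * (p - 1)⁻¹ * 2 ^ (p - 1)) * N))) := by
        refine mul_le_mul' le_rfl (mul_le_mul' (mul_le_mul' le_rfl ?_)
          (mul_le_mul' le_rfl (mul_le_mul' le_rfl hNle)))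
        exact ENNReal.rpow_le_rpow hNle (div_nonneg (by linarith) hp0.le)
    _ = _ := by ring

lemma lev_bound (n : ℕ) (hn : 1 ≤ n) {α : ℝ} (hβ : 0 < α / (n : ℝ)) (hβ1 : α / (n : ℝ) < 1)
    {p q : ℝ} (hp : 1 < p)
    (hpq : p < q) (hpqβ : 1 / p - 1 / q = α / (n : ℝ)) {w f : (Fin n → ℝ) → ℝ} (hw : Measurable w)
    (hf : Measurable f) (hw0 : ∀ x, 0 ≤ w x)
    (hpos : ∀ᵐ x ∂(volume : Measure (Fin n → ℝ)), 0 < w x) (hK : ApqStarConst n p q w ≠ ∞)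
    (hN : (∫⁻ x, ENNReal.ofReal (|f x| ^ p * w x ^ p)) ≠ ∞) {t : ℝ≥0∞} (ht0 : t ≠ 0)
    (htt : t ≠ ∞) :
    t ^ q * volume {x | t < ENNReal.ofReal (w x) * fracMaximalFn n α f x} ≤
      ((6 ^ n) ^ q * (2 ^ n * ((2 * 2 ^ n) ^ q * (4 * 4 ^ (p / (p - 1) / q) *
      ENNReal.ofReal (p * 2 * (p - 1)⁻¹ * 2 ^ (p - 1)))))) *
      (ApqStarConst n p q w ^ (q + p / (p - 1)) *
      (∫⁻ x, ENNReal.ofReal (|f x| ^ p * w x ^ p)) ^ (q / p)) := by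
  have hq : 0 < q := by linarith
  have h60 : (6 ^ n : ℝ≥0∞) ≠ 0 := by positivity
  have h6t : (6 ^ n : ℝ≥0∞) ≠ ∞ := ENNReal.pow_ne_top (by norm_num)
  set τ := t * (6 ^ n)⁻¹ with hτ
  have hτ0 : τ ≠ 0 := mul_ne_zero ht0 (ENNReal.inv_ne_zero.2 h6t)
  have hτt : τ ≠ ∞ := ENNReal.mul_ne_top htt (ENNReal.inv_ne_top.2 h60)
  have htτ : t = 6 ^ n * τ := by
    rw [hτ, mul_left_comm, ENNReal.mul_inv_cancel h60 h6t, mul_one]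
  set G := (((2 : ℝ≥0∞) * 2 ^ n) ^ q * (4 * 4 ^ (p / (p - 1) / q) *
      ENNReal.ofReal (p * 2 * (p - 1)⁻¹ * 2 ^ (p - 1)))) with hG
  set H := (ApqStarConst n p q w ^ (q + p / (p - 1)) *
      (∫⁻ x, ENNReal.ofReal (|f x| ^ p * w x ^ p)) ^ (q / p)) with hH
  have hs : ∀ s, τ ^ q * volume (⋃ R, levR n (α / n) w f τ s R) ≤ G * H := by
    intro s
    rw [(levR_mono n (α / n) w f τ s).measure_iUnion, ENNReal.mul_iSup]
    exact iSup_le fun R => levR_bound n hn hβ hβ1 hp hpq hpqβ hw hf hw0 hpos hK hN hτ0 hτt s R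
  calc t ^ q * volume {x | t < ENNReal.ofReal (w x) * fracMaximalFn n α f x}
      ≤ t ^ q * ∑ s : Fin n → Bool, volume (⋃ R, levR n (α / n) w f τ s R) := by
        refine mul_le_mul' le_rfl ?_
        exact (measure_mono (lev_sub n hβ hf t)).trans (measure_iUnion_fintype_le _ _)
    _ = (6 ^ n) ^ q * ∑ s : Fin n → Bool, τ ^ q * volume (⋃ R, levR n (α / n) w f τ s R) := by
        rw [← Finset.mul_sum, ← mul_assoc, ← ENNReal.mul_rpow_of_nonneg _ _ hq.le, ← htτ]
    _ ≤ (6 ^ n) ^ q * ∑ s : Fin n → Bool, G * H := by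
        exact mul_le_mul' le_rfl (Finset.sum_le_sum fun s _ => hs s)
    _ = _ := by
        rw [Finset.sum_const, Finset.card_univ, nsmul_eq_mul]
        simp only [Fintype.card_fun, Fintype.card_bool, Fintype.card_fin]
        push_cast
        ring

/-- Quantitative sufficiency for the fractional maximal operator:
there is `C = C(n,p,α) > 0` such that for every `w ∈ A_{p,q}^*` and every `f ∈ L^p(w^p)`,
`‖w·M_α f‖_{L^{q,∞}} ≤ C·[w]^{1+p'/q}·‖f‖_{L^p(w^p)}`. -/
theorem statement3 (n : ℕ) (hn : 1 ≤ n) (α : ℝ) (hα : 0 < α) (hαn : α < (n : ℝ))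
    (p : ℝ) (hp : 1 < p) (hpn : p < (n : ℝ) / α) (q : ℝ)
    (hq : 1 / p - 1 / q = α / (n : ℝ)) :
    ∃ C : ℝ, 0 < C ∧ ∀ w : (Fin n → ℝ) → ℝ, Measurable w → (∀ x, 0 ≤ w x) →
      (∀ᵐ x ∂(volume : Measure (Fin n → ℝ)), 0 < w x) → ApqStarConst n p q w < ∞ →
      ∀ f : (Fin n → ℝ) → ℝ, Measurable f →
        (∫⁻ x, ENNReal.ofReal (|f x| ^ p * w x ^ p)) < ∞ →
        wnormE n q (fun x => ENNReal.ofReal (w x) * fracMaximalFn n α f x) ≤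
          ENNReal.ofReal C * ApqStarConst n p q w ^ (1 + (p / (p - 1)) / q) *
            (∫⁻ x, ENNReal.ofReal (|f x| ^ p * w x ^ p)) ^ (1 / p) := by
  have hn0 : (0 : ℝ) < n := by exact_mod_cast hn
  have hp0 : 0 < p := by linarith
  have hp1 : 0 < p - 1 := by linarith
  have hβ : 0 < α / (n : ℝ) := by positivity
  have hβ1 : α / (n : ℝ) < 1 := by rw [div_lt_one hn0]; exact hαn
  have hq1 : 0 < 1 / q := by
    have : α / n < 1 / p := by
      rw [lt_div_iff₀ hα] at hpn
      rw [div_lt_div_iff₀ hn0 hp0]; linarith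
    linarith
  have hq0 : 0 < q := one_div_pos.1 hq1
  have hpq : p < q := by
    have : 1 / q < 1 / p := by linarith
    exact (one_div_lt_one_div hq0 hp0).1 this
  set A : ℝ≥0∞ := ((6 ^ n) ^ q * (2 ^ n * ((2 * 2 ^ n) ^ q * (4 * 4 ^ (p / (p - 1) / q) *
      ENNReal.ofReal (p * 2 * (p - 1)⁻¹ * 2 ^ (p - 1)))))) with hA
  have hpw : ∀ (a : ℝ≥0∞) (r : ℝ), a ≠ 0 → a ≠ ∞ → a ^ r ≠ 0 ∧ a ^ r ≠ ∞ := fun a r h h' =>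
    ⟨(ENNReal.rpow_pos (pos_iff_ne_zero.2 h) h').ne', ENNReal.rpow_ne_top_of_ne_zero h h'⟩
  have h6 := hpw (6 ^ n) q (by positivity) (ENNReal.pow_ne_top (by norm_num))
  have h2 := hpw (2 * 2 ^ n) q (by positivity)
    (ENNReal.mul_ne_top (by norm_num) (ENNReal.pow_ne_top (by norm_num)))
  have h4 := hpw 4 (p / (p - 1) / q) (by positivity) (by norm_num)
  have hc : ENNReal.ofReal (p * 2 * (p - 1)⁻¹ * 2 ^ (p - 1)) ≠ 0 := by
    rw [Ne, ENNReal.ofReal_eq_zero, not_le]; positivity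
  have hA0 : A ≠ 0 := mul_ne_zero h6.1 (mul_ne_zero (by positivity) (mul_ne_zero h2.1
    (mul_ne_zero (mul_ne_zero (by norm_num) h4.1) hc)))
  have hAt : A ≠ ∞ := ENNReal.mul_ne_top h6.2 (ENNReal.mul_ne_top
    (ENNReal.pow_ne_top (by norm_num)) (ENNReal.mul_ne_top h2.2
    (ENNReal.mul_ne_top (ENNReal.mul_ne_top (by norm_num) h4.2) ENNReal.ofReal_ne_top)))
  have hA' := hpw A (1 / q) hA0 hAt
  refine ⟨(A ^ (1 / q)).toReal, ENNReal.toReal_pos hA'.1 hA'.2, ?_⟩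
  intro w hw hw0 hpos hK f hf hN
  rw [ENNReal.ofReal_toReal hA'.2]
  refine iSup₂_le fun t ht => ?_
  have hb := lev_bound n hn hβ hβ1 hp hpq hq hw hf hw0 hpos hK.ne hN.ne
    (t := ENNReal.ofReal t) (by rw [Ne, ENNReal.ofReal_eq_zero, not_le]; exact ht)
    ENNReal.ofReal_ne_top
  rw [← hA] at hb
  clear_value A
  have hb' := ENNReal.rpow_le_rpow hb hq1.le
  rw [ENNReal.mul_rpow_of_nonneg _ _ hq1.le, ENNReal.mul_rpow_of_nonneg _ _ hq1.le,
    ENNReal.mul_rpow_of_nonneg _ _ hq1.le, ← ENNReal.rpow_mul, ← ENNReal.rpow_mul,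
    ← ENNReal.rpow_mul, mul_one_div_cancel hq0.ne', ENNReal.rpow_one,
    show (q + p / (p - 1)) * (1 / q) = 1 + p / (p - 1) / q by field_simp,
    show q / p * (1 / q) = 1 / p by field_simp, ← mul_assoc] at hb'
  exact hb'
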